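/- arXiv:2107.14516 — 11 statements merged into one kernel-verified Lean document; each statement's English description precedes it below -/
import Mathlib

section
/- Let H be a real Hilbert space, let A, T : H → H be bounded linear operators with T invertible (with bounded inverse), let K : H → H be a compact linear operator, and suppose there is α > 0 such that ⟨A u, T u⟩ + ⟨K u, u⟩ ≥ α ‖u‖² for all u ∈ H. Then the operator T* A + K : H → H is invertible with bounded inverse, and consequently A can be written as A = S + K′ where S := (T*)⁻¹ (T* A + K) is an invertible bounded linear operator and K′ := −(T*)⁻¹ K is compact. -/
open RealInnerProductSpace ContinuousLinearMap

/-- If `T` is invertible (with bounded inverse `T'`), `K` is compact, and the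
bilinear form `(u,v) ↦ ⟨Au, Tv⟩ + ⟨Ku, v⟩` is coercive, then `T* A + K` is invertible with
bounded inverse, and `A = S + K'` with `S = (T*)⁻¹ (T* A + K)` invertible and
`K' = -(T*)⁻¹ K` compact. Here `(T*)⁻¹ = (T')*`. -/
theorem stmt_0 {H : Type*} [NormedAddCommGroup H] [InnerProductSpace ℝ H] [CompleteSpace H]
    (A T K : H →L[ℝ] H) (T' : H →L[ℝ] H)
    (hT'l : T' ∘L T = ContinuousLinearMap.id ℝ H)
    (hT'r : T ∘L T' = ContinuousLinearMap.id ℝ H)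
    (hK : IsCompactOperator (⇑K))
    (α : ℝ) (hα : 0 < α)
    (hcoer : ∀ u : H, ⟪A u, T u⟫ + ⟪K u, u⟫ ≥ α * ‖u‖ ^ 2) :
    (∃ B : H →L[ℝ] H,
        B ∘L (adjoint T ∘L A + K) = ContinuousLinearMap.id ℝ H ∧
        (adjoint T ∘L A + K) ∘L B = ContinuousLinearMap.id ℝ H) ∧
    A = adjoint T' ∘L (adjoint T ∘L A + K) + (-(adjoint T' ∘L K)) ∧
    (∃ S' : H →L[ℝ] H,
        S' ∘L (adjoint T' ∘L (adjoint T ∘L A + K)) = ContinuousLinearMap.id ℝ H ∧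
        (adjoint T' ∘L (adjoint T ∘L A + K)) ∘L S' = ContinuousLinearMap.id ℝ H) ∧
    IsCompactOperator (⇑(-(adjoint T' ∘L K))) := by
  have hM : IsUnit (adjoint T ∘L A + K) :=
    isUnit_of_forall_le_norm_inner_map _ (c := ⟨α, hα.le⟩) hα fun u => calc
      ‖u‖ ^ 2 * α = α * ‖u‖ ^ 2 := mul_comm _ _
      _ ≤ ⟪A u, T u⟫ + ⟪K u, u⟫ := hcoer u
      _ = ⟪(adjoint T ∘L A + K) u, u⟫ := by simp [inner_add_left, adjoint_inner_left]
      _ ≤ ‖⟪(adjoint T ∘L A + K) u, u⟫‖ := Real.le_norm_self _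
  have hl : adjoint T' ∘L adjoint T = ContinuousLinearMap.id ℝ H := by
    rw [← adjoint_comp, hT'r, adjoint_id]
  have hr : adjoint T ∘L adjoint T' = ContinuousLinearMap.id ℝ H := by
    rw [← adjoint_comp, hT'l, adjoint_id]
  have hS : IsUnit (adjoint T' ∘L (adjoint T ∘L A + K)) :=
    IsUnit.mul (isUnit_iff_exists.mpr ⟨adjoint T, hl, hr⟩) hM
  obtain ⟨B, hB₁, hB₂⟩ := isUnit_iff_exists.mp hM
  obtain ⟨S', hS₁, hS₂⟩ := isUnit_iff_exists.mp hS
  refine ⟨⟨B, hB₂, hB₁⟩, ?_, ⟨S', hS₂, hS₁⟩, (hK.clm_comp (adjoint T')).neg⟩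
  rw [comp_add, ← comp_assoc, hl, id_comp, add_neg_cancel_right]
end

section
/- Let H be a real Hilbert space, let A : H → H be a bounded self-adjoint linear operator that can be written as A = S + K₀ with S : H → H invertible (with bounded inverse) and K₀ : H → H compact, and let C : H → H be a compact self-adjoint linear operator satisfying ⟨C u, u⟩ > 0 for every u ∈ H with u ≠ 0. Then there exists ℓ ∈ ℝ such that the (self-adjoint) operator A + ℓ C : H → H is invertible with bounded inverse. -/
open RealInnerProductSpace ContinuousLinearMap

open Filter Topology

/-- A compact perturbation of an invertible operator is invertible as soon as it is injective. -/
theorem IsUnit.add_isCompactOperator_of_injective {𝕜 X : Type*} [NontriviallyNormedField 𝕜]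
    [NormedAddCommGroup X] [NormedSpace 𝕜 X] [CompleteSpace X] {S K : X →L[𝕜] X}
    (hS : IsUnit S) (hK : IsCompactOperator K) (hinj : ∀ x, (S + K) x = 0 → x = 0) :
    IsUnit (S + K) := by
  obtain ⟨S, rfl⟩ := hS
  have hfactor : (S : X →L[𝕜] X) + K = S * (1 + ↑S⁻¹ * K) := by
    rw [mul_add, mul_one, Units.mul_inv_cancel_left]
  have hT : IsCompactOperator (↑S⁻¹ * K : X →L[𝕜] X) := hK.clm_comp (↑S⁻¹ : X →L[𝕜] X)
  rw [hfactor] at hinj ⊢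
  refine S.isUnit.mul ?_
  rcases hT.hasEigenvalue_or_mem_resolventSet (neg_ne_zero.2 (one_ne_zero (α := 𝕜))) with h | h
  · obtain ⟨x, hx⟩ := h.exists_hasEigenvector
    refine absurd (hinj x ?_) hx.2
    have hx' : (↑S⁻¹ * K : X →L[𝕜] X) x = (-1 : 𝕜) • x := hx.apply_eq_smul
    change (S : X →L[𝕜] X) (x + (↑S⁻¹ * K : X →L[𝕜] X) x) = 0
    rw [hx', neg_one_smul, add_neg_cancel, map_zero]
  · rw [spectrum.mem_resolventSet_iff, ← IsUnit.neg_iff] at h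
    convert h using 1
    simp [add_comm]

section

variable {H : Type*} [NormedAddCommGroup H] [InnerProductSpace ℝ H] {A C : H →L[ℝ] H}

/-- Kernel vectors of `A + ℓ C` and `A + m C` with `ℓ ≠ m` are `C`-orthogonal. -/
theorem inner_apply_eq_zero_of_add_smul_apply_eq_zero
    (hA : (A : H →ₗ[ℝ] H).IsSymmetric) (hC : (C : H →ₗ[ℝ] H).IsSymmetric) {l m : ℝ} (hlm : l ≠ m)
    {u v : H} (hu : (A + l • C) u = 0) (hv : (A + m • C) v = 0) : ⟪C u, v⟫ = 0 := by
  have hAuv : ⟪A u, v⟫ = ⟪u, A v⟫ := hA u v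
  have hCuv : ⟪C u, v⟫ = ⟪u, C v⟫ := hC u v
  have hu' : A u = -(l • C u) := eq_neg_of_add_eq_zero_left hu
  have hv' : A v = -(m • C v) := eq_neg_of_add_eq_zero_left hv
  rw [hu', hv', inner_neg_left, inner_neg_right, real_inner_smul_left, real_inner_smul_right,
    ← hCuv] at hAuv
  have : (l - m) * ⟪C u, v⟫ = 0 := by linarith
  exact (mul_eq_zero.1 this).resolve_left (sub_ne_zero.2 hlm)

/-- For a compact perturbation `S + K` of an invertible operator, unit vectors `u n` with
`(S + K + a n • C) (u n) = 0`, where `a` converges and `C` is compact, have a convergent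
subsequence. -/
theorem exists_tendsto_subseq_of_add_smul_apply_eq_zero {S K : H →L[ℝ] H} (hS : IsUnit S)
    (hK : IsCompactOperator K) (hC : IsCompactOperator C) {a : ℕ → ℝ} {b : ℝ}
    (ha : Tendsto a atTop (𝓝 b)) {u : ℕ → H} (hu : ∀ n, ‖u n‖ = 1)
    (hu0 : ∀ n, (S + K + a n • C) (u n) = 0) :
    ∃ x, ∃ φ : ℕ → ℕ, StrictMono φ ∧ Tendsto (u ∘ φ) atTop (𝓝 x) := by
  obtain ⟨S, rfl⟩ := hS
  have hmem : ∀ n, u n ∈ Metric.closedBall (0 : H) 1 := fun n ↦ by simp [hu n]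
  obtain ⟨P, hP, hPs⟩ := hK.image_closedBall_subset_compact (f := (K : H →ₗ[ℝ] H)) 1
  obtain ⟨Q, hQ, hQs⟩ := hC.image_closedBall_subset_compact (f := (C : H →ₗ[ℝ] H)) 1
  obtain ⟨⟨y, z⟩, -, φ, hφ, hlim⟩ := (hP.prod hQ).tendsto_subseq (x := fun n ↦ (K (u n), C (u n)))
    fun n ↦ ⟨hPs ⟨u n, hmem n, rfl⟩, hQs ⟨u n, hmem n, rfl⟩⟩
  rw [Prod.tendsto_iff] at hlim
  refine ⟨(↑S⁻¹ : H →L[ℝ] H) (-(y + b • z)), φ, hφ, ?_⟩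
  have hsolve : ∀ n, u n = (↑S⁻¹ : H →L[ℝ] H) (-(K (u n) + a n • C (u n))) := fun n ↦ by
    have h : (S : H →L[ℝ] H) (u n) = -(K (u n) + a n • C (u n)) :=
      eq_neg_of_add_eq_zero_left (by simpa [add_assoc] using hu0 n)
    rw [← h]
    exact (DFunLike.congr_fun S.inv_mul (u n)).symm
  refine Tendsto.congr (fun n ↦ (hsolve (φ n)).symm) ?_
  exact ((↑S⁻¹ : H →L[ℝ] H).continuous.tendsto _).comp
    (hlim.1.add ((ha.comp hφ.tendsto_atTop).smul hlim.2)).neg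

/-- If `S + K` is a symmetric compact perturbation of an invertible operator and `C` is compact,
symmetric and positive definite, then `S + K + l C` is injective for some real `l`. -/
theorem exists_forall_add_smul_apply_eq_zero {S K : H →L[ℝ] H} (hS : IsUnit S)
    (hK : IsCompactOperator K) (hA : ((S + K : H →L[ℝ] H) : H →ₗ[ℝ] H).IsSymmetric)
    (hCcomp : IsCompactOperator C) (hC : (C : H →ₗ[ℝ] H).IsSymmetric)
    (hCpos : ∀ u : H, u ≠ 0 → 0 < ⟪C u, u⟫) :
    ∃ l : ℝ, ∀ x, (S + K + l • C) x = 0 → x = 0 := by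
  by_contra! h
  have hunit : ∀ l : ℝ, ∃ u : H, (S + K + l • C) u = 0 ∧ ‖u‖ = 1 := fun l ↦ by
    obtain ⟨x, hx, hx0⟩ := h l
    exact ⟨‖x‖⁻¹ • x, by rw [map_smul, hx, smul_zero], norm_smul_inv_norm (𝕜 := ℝ) hx0⟩
  choose v hv hv1 using hunit
  let a : ℕ → ℝ := fun n ↦ 1 / ((n : ℝ) + 1)
  have ha : a.Injective := fun m n hmn ↦ by simpa [a] using hmn
  obtain ⟨x, φ, hφ, hlim⟩ := exists_tendsto_subseq_of_add_smul_apply_eq_zero hS hK hCcomp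
    tendsto_one_div_add_atTop_nhds_zero_nat (u := fun n ↦ v (a n)) (fun n ↦ hv1 _) (fun n ↦ hv _)
  have hx1 : ‖x‖ = 1 := tendsto_nhds_unique hlim.norm
    (tendsto_const_nhds.congr fun n ↦ (hv1 (a (φ n))).symm)
  have hinner := ((C.continuous.tendsto x).comp hlim).inner (𝕜 := ℝ)
    (hlim.comp (tendsto_add_atTop_nat 1))
  have hx0 : ⟪C x, x⟫ = 0 := tendsto_nhds_unique hinner <| tendsto_const_nhds.congr fun n ↦
    (inner_apply_eq_zero_of_add_smul_apply_eq_zero hA hC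
      (ha.ne (hφ.injective.ne n.succ_ne_self.symm)) (hv _) (hv _)).symm
  exact (hCpos x (norm_ne_zero_iff.1 (hx1 ▸ one_ne_zero))).ne' hx0

end

/-- If the bounded self-adjoint operator `A` is a compact perturbation of an
invertible operator and `C` is compact, self-adjoint and positive definite, then there exists
`ℓ ∈ ℝ` such that `A + ℓ C` is invertible with bounded inverse. -/
theorem stmt_1 {H : Type*} [NormedAddCommGroup H] [InnerProductSpace ℝ H] [CompleteSpace H]
    (A S K₀ C : H →L[ℝ] H)
    (hA : IsSelfAdjoint A)
    (hAS : A = S + K₀)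
    (hS : ∃ S' : H →L[ℝ] H,
        S' ∘L S = ContinuousLinearMap.id ℝ H ∧ S ∘L S' = ContinuousLinearMap.id ℝ H)
    (hK₀ : IsCompactOperator (⇑K₀))
    (hCcomp : IsCompactOperator (⇑C)) (hCsa : IsSelfAdjoint C)
    (hCpos : ∀ u : H, u ≠ 0 → 0 < ⟪C u, u⟫) :
    ∃ ℓ : ℝ, ∃ B : H →L[ℝ] H,
      B ∘L (A + ℓ • C) = ContinuousLinearMap.id ℝ H ∧
      (A + ℓ • C) ∘L B = ContinuousLinearMap.id ℝ H := by
  subst hAS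
  obtain ⟨S', hS'S, hSS'⟩ := hS
  have hSunit : IsUnit S := ⟨⟨S, S', hSS', hS'S⟩, rfl⟩
  obtain ⟨l, hl⟩ := exists_forall_add_smul_apply_eq_zero hSunit hK₀ hA.isSymmetric hCcomp
    hCsa.isSymmetric hCpos
  refine ⟨l, ?_⟩
  rw [add_assoc] at hl ⊢
  obtain ⟨U, hU⟩ := hSunit.add_isCompactOperator_of_injective (hK₀.add (hCcomp.smul l)) hl
  rw [← hU]
  exact ⟨↑U⁻¹, U.inv_mul, U.mul_inv⟩
end

section
/- Let N be a positive natural number, D > 0, ℓ ∈ ℝ, and let (μ_j)_{j ∈ ℤ∖{0}} be a family of nonzero real numbers satisfying |μ_j| ≤ D |j|^{−2/N} for all j ∈ ℤ∖{0}. Define λ_j := μ_j⁻¹ − ℓ. Then there exists a constant M > 0 such that for every Λ ≥ 1 the number of indices j ∈ ℤ∖{0} with −Λ ≤ λ_j ≤ Λ is at most M Λ^{N/2}. -/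
/-- At most `2 * R` nonzero integers have absolute value at most `R`. -/
theorem finite_and_card_le_of_nonzero_abs_le {S : Set ℤ} {R : ℝ} (hR : 0 ≤ R)
    (hS : ∀ j ∈ S, j ≠ 0 ∧ |(j : ℝ)| ≤ R) :
    ∃ hfin : S.Finite, (hfin.toFinset.card : ℝ) ≤ 2 * R := by
  set m : ℕ := ⌊R⌋₊
  have hsub : S ⊆ ↑((Finset.Icc (-(m : ℤ)) m).erase 0) := by
    intro j hj
    obtain ⟨h0, hle⟩ := hS j hj
    have hnat : j.natAbs ≤ m := Nat.le_floor (by rwa [Nat.cast_natAbs, Int.cast_abs])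
    simp only [Finset.coe_erase, Finset.coe_Icc, Set.mem_sdiff, Set.mem_Icc, Set.mem_singleton_iff]
    omega
  have hfin : S.Finite := (Finset.finite_toSet _).subset hsub
  refine ⟨hfin, ?_⟩
  have hcard : hfin.toFinset.card ≤ 2 * m := by
    calc hfin.toFinset.card ≤ ((Finset.Icc (-(m : ℤ)) m).erase 0).card :=
          Finset.card_le_card (hfin.toFinset_subset.2 hsub)
      _ = 2 * m := by
          rw [Finset.card_erase_of_mem (by simp), Int.card_Icc]
          omega
  calc (hfin.toFinset.card : ℝ) ≤ 2 * m := by exact_mod_cast hcard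
    _ ≤ 2 * R := by gcongr; exact Nat.floor_le hR

/-- A power-law bound on a nonzero number `y` bounds the base in terms of `y⁻¹`. -/
theorem le_rpow_of_abs_le_mul_rpow_neg {D x y s K : ℝ} (hx : 0 < x) (hs : 0 < s)
    (hy : y ≠ 0) (hD : 0 ≤ D) (hbound : |y| ≤ D * x ^ (-s)) (hK : |y⁻¹| ≤ K) :
    x ≤ (D * K) ^ s⁻¹ := by
  have hxs : 0 < x ^ s := Real.rpow_pos_of_pos hx s
  have hy' : 0 < |y| := abs_pos.2 hy
  have hmul : |y| * x ^ s ≤ D := by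
    rwa [Real.rpow_neg hx.le, ← div_eq_mul_inv, le_div_iff₀ hxs] at hbound
  have hle : x ^ s ≤ D * K := by
    calc x ^ s ≤ D * |y|⁻¹ := by rwa [← div_eq_mul_inv, le_div_iff₀ hy', mul_comm]
      _ ≤ D * K := by rw [← abs_inv]; gcongr
  exact (Real.le_rpow_inv_iff_of_pos hx.le (hxs.le.trans hle) hs).2 hle


/-- eigenvalue counting estimate. If `|μ_j| ≤ D |j|^{-2/N}` for nonzero
`μ_j`, and `λ_j = μ_j⁻¹ - ℓ`, then there is `M > 0` such that for every `Λ ≥ 1` the set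
of indices `j ≠ 0` with `-Λ ≤ λ_j ≤ Λ` is finite with cardinality at most `M Λ^{N/2}`. -/
theorem stmt_4 (N : ℕ) (hN : 0 < N) (D ℓ : ℝ) (hD : 0 < D)
    (μ : ℤ → ℝ) (hμ : ∀ j : ℤ, j ≠ 0 → μ j ≠ 0)
    (hbound : ∀ j : ℤ, j ≠ 0 → |μ j| ≤ D * (|(j : ℝ)|) ^ (-(2 : ℝ) / (N : ℝ))) :
    ∃ M : ℝ, 0 < M ∧ ∀ Λ : ℝ, 1 ≤ Λ →
      ∃ hfin : {j : ℤ | j ≠ 0 ∧ -Λ ≤ (μ j)⁻¹ - ℓ ∧ (μ j)⁻¹ - ℓ ≤ Λ}.Finite,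
        (hfin.toFinset.card : ℝ) ≤ M * Λ ^ ((N : ℝ) / 2) := by
  have hN' : (0 : ℝ) < N := by exact_mod_cast hN
  have hB : 0 < D * (1 + |ℓ|) := by positivity
  refine ⟨2 * (D * (1 + |ℓ|)) ^ ((N : ℝ) / 2), by positivity, fun Λ hΛ => ?_⟩
  rw [mul_assoc, ← Real.mul_rpow hB.le (by linarith), mul_assoc]
  refine finite_and_card_le_of_nonzero_abs_le (by positivity) ?_
  rintro j ⟨hj, hl, hu⟩
  refine ⟨hj, ?_⟩
  have hK : |(μ j)⁻¹| ≤ (1 + |ℓ|) * Λ := by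
    calc |(μ j)⁻¹| = |((μ j)⁻¹ - ℓ) + ℓ| := by rw [sub_add_cancel]
      _ ≤ |(μ j)⁻¹ - ℓ| + |ℓ| := abs_add_le _ _
      _ ≤ Λ + |ℓ| * Λ :=
          add_le_add (abs_le.2 ⟨hl, hu⟩) (le_mul_of_one_le_right (abs_nonneg ℓ) hΛ)
      _ = (1 + |ℓ|) * Λ := by ring
  have hpow := hbound j hj
  rw [neg_div] at hpow
  have hj' : 0 < |(j : ℝ)| := abs_pos.2 (by exact_mod_cast hj)
  simpa only [inv_div] using
    le_rpow_of_abs_le_mul_rpow_neg hj' (by positivity) (hμ j hj) hD.le hpow hK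
end

section
/- Let H be a separable real Hilbert space and let Ψ : H × ℝ → ℝ be twice continuously differentiable such that the gradient of Ψ_λ := Ψ(·, λ) has the form ∇Ψ_λ(u) = L u − λ K u − G(u), where (i) L : H → H is a bounded self-adjoint linear operator which is invertible with bounded inverse, (ii) K : H → H is a compact self-adjoint linear operator with ⟨K u, u⟩ > 0 for all u ≠ 0, and (iii) G : H → H satisfies G(0) = 0 and G′(0) = 0. Then every λ⋆ ∈ ℝ such that ker(L − λ⋆ K) ≠ {0} is a bifurcation point for the equation ∇Ψ_λ(u) = 0: there exists a sequence (uₙ, λₙ) in (H ∖ {0}) × ℝ with L uₙ − λₙ K uₙ − G(uₙ) = 0 for all n and (uₙ, λₙ) → (0, λ⋆) in H × ℝ. -/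
open RealInnerProductSpace ContinuousLinearMap Filter Topology

section Linear

variable {H : Type*} [NormedAddCommGroup H] [InnerProductSpace ℝ H]

theorem finiteDimensional_ker_sub_smul {L L' K : H →L[ℝ] H}
    (hL' : L' ∘L L = ContinuousLinearMap.id ℝ H) (hK : IsCompactOperator K) (lam : ℝ) :
    FiniteDimensional ℝ (LinearMap.ker (L - lam • K).toLinearMap) := by
  set N := LinearMap.ker (L - lam • K).toLinearMap
  have hid : ∀ x ∈ N, (L' ∘L (lam • K)) x = x := by
    intro x hx
    have h : L x - lam • K x = 0 := by simpa [N] using hx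
    rw [ContinuousLinearMap.comp_apply, smul_apply, ← sub_eq_zero.1 h]
    exact congr($hL' x)
  have hc : IsCompactOperator (L' ∘L (lam • K)).toLinearMap := (hK.smul lam).clm_comp L'
  have hmem : ∀ x ∈ N, (L' ∘L (lam • K)).toLinearMap x ∈ N := fun x hx => by
    rw [ContinuousLinearMap.coe_coe, hid x hx]; exact hx
  have hN : IsClosed (N : Set H) := (L - lam • K).isClosed_ker
  refine FiniteDimensional.of_isCompactOperator_id (𝕜 := ℝ) (E := N) ?_
  have hid' : ⇑((L' ∘L (lam • K)).toLinearMap.restrict hmem) = id :=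
    funext fun x => Subtype.ext (hid x x.2)
  exact hid' ▸ hc.restrict hmem hN

/-- The inverse of the compression of a positive operator to a finite-dimensional subspace. -/
theorem exists_compression_inverse {K : H →L[ℝ] H} (hKpos : ∀ u : H, u ≠ 0 → 0 < ⟪K u, u⟫)
    (N : Submodule ℝ H) [FiniteDimensional ℝ N] :
    ∃ J : H →L[ℝ] H, (∀ y, J y ∈ N) ∧ ∀ y, ∀ n ∈ N, ⟪K (J y), n⟫ = ⟪y, n⟫ := by
  set P := N.orthogonalProjectionOnto
  have hP : ∀ y, ∀ n : N, ⟪(P y : H), n⟫ = ⟪y, n⟫ := fun y n => by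
    rw [← Submodule.coe_inner, Submodule.inner_orthogonalProjectionOnto_eq_of_mem_right]
  let S : N →L[ℝ] N := P ∘L K ∘L N.subtypeL
  have hS : Function.Injective S.toLinearMap := by
    rw [← LinearMap.ker_eq_bot, LinearMap.ker_eq_bot']
    intro m hm
    by_contra hne
    have h := hKpos m (by simpa using hne)
    rw [← hP] at h
    have : P (K m) = 0 := hm
    simp [this] at h
  let e := LinearEquiv.ofInjectiveEndo S.toLinearMap hS
  refine ⟨N.subtypeL ∘L (LinearMap.toContinuousLinearMap e.symm.toLinearMap) ∘L P,
    fun y => by simp, fun y n hn => ?_⟩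
  have h : P (K (e.symm (P y))) = P y := e.apply_symm_apply (P y)
  have h1 := hP (K (e.symm (P y))) ⟨n, hn⟩
  have h2 := hP y ⟨n, hn⟩
  rw [h, h2] at h1
  exact h1.symm

/-- A solution operator for `L w - lam • K w = y` modulo `K (ker (L - lam • K))`, with values in the
`K`-orthogonal complement of the kernel. -/
theorem exists_solution_operator [CompleteSpace H] {L L' K J : H →L[ℝ] H} (hLsa : IsSelfAdjoint L)
    (hKsa : IsSelfAdjoint K)
    (hLL' : L ∘L L' = ContinuousLinearMap.id ℝ H) (hK : IsCompactOperator K)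
    (hKpos : ∀ u : H, u ≠ 0 → 0 < ⟪K u, u⟫) (lam : ℝ)
    (hJ : ∀ y, (L - lam • K) (J y) = 0)
    (hJK : ∀ y n, (L - lam • K) n = 0 → ⟪K (J y), n⟫ = ⟪y, n⟫) :
    ∃ V : H →L[ℝ] H, (∀ y n, (L - lam • K) n = 0 → ⟪K (V y), n⟫ = 0) ∧
      ∀ y, (L - lam • K) (V y) = y - K (J y) := by
  set A := L - lam • K with hA
  have hAsym : ∀ x n, A n = 0 → ⟪A x, n⟫ = 0 := fun x n hn => by
    have hL : ⟪L x, n⟫ = ⟪x, L n⟫ := hLsa.isSymmetric x n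
    have hK : ⟪K x, n⟫ = ⟪x, K n⟫ := hKsa.isSymmetric x n
    have h : ⟪x, A n⟫ = 0 := by rw [hn, inner_zero_right]
    simpa [hA, inner_sub_left, inner_sub_right, inner_smul_left, inner_smul_right, hL, hK] using h
  have hpair : ∀ w y, A w + K (J (K w)) = y - K (J y) →
      (∀ n, A n = 0 → ⟪K w, n⟫ = 0) ∧ A w = y - K (J y) := by
    intro w y h
    have h1 : ∀ n, A n = 0 → ⟪K w, n⟫ = 0 := fun n hn => by
      have := congr(⟪$h, n⟫)
      rw [inner_add_left, inner_sub_left, hAsym w n hn, hJK _ n hn, hJK _ n hn] at this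
      linarith
    have h2 : J (K w) = 0 := by
      by_contra hne
      have := hKpos _ hne
      rw [hJK _ _ (hJ _), h1 _ (hJ _)] at this
      exact this.false
    refine ⟨h1, ?_⟩
    rw [← h, h2]; simp
  let C : H →L[ℝ] H := L' ∘L K ∘L (lam • ContinuousLinearMap.id ℝ H - J ∘L K)
  have hC : IsCompactOperator C :=
    (hK.comp_clm (lam • ContinuousLinearMap.id ℝ H - J ∘L K)).clm_comp L'
  have hLC : ∀ x, L (x - C x) = A x + K (J (K x)) := fun x => by
    have : ∀ z, L (L' z) = z := fun z => congr($hLL' z)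
    simp [C, hA, this]
    abel
  have hunit : (1 : ℝ) ∈ resolventSet ℝ C := by
    refine (hC.hasEigenvalue_or_mem_resolventSet one_ne_zero).resolve_left fun h => ?_
    obtain ⟨x, hx⟩ := h.exists_hasEigenvector
    have hx1 : C x = x := by simpa using hx.apply_eq_smul
    have h0 := hLC x
    rw [hx1, sub_self, map_zero] at h0
    obtain ⟨h1, h2⟩ := hpair x 0 (by rw [← h0]; simp)
    exact (hKpos x hx.2).ne' (h1 x (by simpa using h2))
  obtain ⟨U, hU⟩ := hunit
  have hUinv : ∀ z, (U⁻¹.1 z) - C (U⁻¹.1 z) = z := fun z => by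
    have := congr($(U.mul_inv) z)
    rw [hU] at this
    simpa using this
  refine ⟨U⁻¹.1 ∘L L' ∘L (ContinuousLinearMap.id ℝ H - K ∘L J), ?_⟩
  have key : ∀ y, A (U⁻¹.1 (L' (y - K (J y)))) + K (J (K (U⁻¹.1 (L' (y - K (J y)))))) =
      y - K (J y) := fun y => by
    rw [← hLC, hUinv]
    exact congr($hLL' _)
  exact ⟨fun y => (hpair _ _ (key y)).1, fun y => (hpair _ _ (key y)).2⟩

/-- The `K`-unit sphere of a finite-dimensional subspace is compact. -/
theorem isCompact_unit_sphere_of_positive {K : H →L[ℝ] H}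
    (hKpos : ∀ u : H, u ≠ 0 → 0 < ⟪K u, u⟫)
    (N : Submodule ℝ H) [FiniteDimensional ℝ N] : IsCompact {θ : H | θ ∈ N ∧ ⟪K θ, θ⟫ = 1} := by
  let g : N → H := fun n => (√⟪K n, n⟫)⁻¹ • (n : H)
  have hg : ContinuousOn g (Metric.sphere 0 1) := by
    refine ContinuousOn.smul (ContinuousOn.inv₀ (by fun_prop) fun n hn => ?_) (by fun_prop)
    have : n ≠ 0 := ne_zero_of_mem_unit_sphere ⟨n, hn⟩
    exact (Real.sqrt_pos.2 (hKpos n (by simpa using this))).ne'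
  convert! (isCompact_sphere (0 : N) 1).image_of_continuousOn hg using 1
  ext θ
  constructor
  · rintro ⟨hθ, h1⟩
    have hne : θ ≠ 0 := by rintro rfl; simp at h1
    have hpos : 0 < ‖θ‖ := norm_pos_iff.2 hne
    refine ⟨‖θ‖⁻¹ • ⟨θ, hθ⟩, ?_, ?_⟩
    · simp [norm_smul, hpos.ne']
    · simp [g, inner_smul_left, inner_smul_right, h1, smul_smul, hpos.ne', Real.sqrt_mul_self]
  · rintro ⟨n, hn, rfl⟩
    have hne : n ≠ 0 := ne_zero_of_mem_unit_sphere ⟨n, hn⟩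
    have h0 := hKpos n (by simpa using hne)
    refine ⟨N.smul_mem _ n.2, ?_⟩
    simp only [g, map_smul, inner_smul_left, inner_smul_right]
    have h2 := Real.mul_self_sqrt h0.le
    have h3 := (Real.sqrt_pos.2 h0).ne'
    simp only [conj_trivial]
    field_simp
    nlinarith

end Linear

section Reduction

/-- A uniformly Lipschitz family of half-contractions of a ball has a Lipschitz family of fixed
points. -/
theorem exists_lipschitz_fixedPoint {P E : Type*} [PseudoMetricSpace P] [NormedAddCommGroup E]
    [CompleteSpace E] (T : P → E → E) {η C : ℝ} (hη : 0 ≤ η)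
    (hT : ∀ θ z z', ‖z‖ ≤ η → ‖z'‖ ≤ η → ‖T θ z - T θ z'‖ ≤ 1 / 2 * ‖z - z'‖)
    (hT0 : ∀ θ, ‖T θ 0‖ ≤ η / 2)
    (hTP : ∀ θ θ' z, ‖z‖ ≤ η → ‖T θ z - T θ' z‖ ≤ C * dist θ θ') :
    ∃ z : P → E, ∀ θ, ‖z θ‖ ≤ η ∧ T θ (z θ) = z θ ∧
      ∀ θ', ‖z θ - z θ'‖ ≤ 2 * C * dist θ θ' := by
  have hex : ∀ θ, ∃ z, ‖z‖ ≤ η ∧ T θ z = z := fun θ => by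
    have hmaps : Set.MapsTo (T θ) (Metric.closedBall 0 η) (Metric.closedBall 0 η) := fun z hz => by
      rw [mem_closedBall_zero_iff] at hz ⊢
      have h1 := hT θ z 0 hz (by simpa using hη)
      have h2 := norm_le_norm_sub_add (T θ z) (T θ 0)
      have h3 := hT0 θ
      rw [sub_zero] at h1
      linarith
    have hcontr : ContractingWith (1 / 2) (hmaps.restrict (T θ) _ _) := by
      refine ⟨by rw [← NNReal.coe_lt_coe]; norm_num, LipschitzWith.of_dist_le_mul fun x y => ?_⟩
      have := hT θ x y (mem_closedBall_zero_iff.1 x.2) (mem_closedBall_zero_iff.1 y.2)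
      simpa [Subtype.dist_eq, dist_eq_norm] using this
    obtain ⟨z, hz, hfix, -⟩ := hcontr.exists_fixedPoint' Metric.isClosed_closedBall.isComplete hmaps
      (Metric.mem_closedBall_self hη) (edist_ne_top _ _)
    exact ⟨z, mem_closedBall_zero_iff.1 hz, hfix⟩
  choose z hz hfix using hex
  refine ⟨z, fun θ => ⟨hz θ, hfix θ, fun θ' => ?_⟩⟩
  have h1 := hT θ (z θ) (z θ') (hz θ) (hz θ')
  have h2 := hTP θ θ' (z θ') (hz θ')
  have h3 := norm_sub_le_norm_sub_add_norm_sub (T θ (z θ)) (T θ (z θ')) (T θ' (z θ'))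
  rw [hfix θ, hfix θ'] at *
  linarith

variable {H : Type*} [NormedAddCommGroup H] [InnerProductSpace ℝ H]

theorem abs_mul_sub_mul_le {a b a' b' η d : ℝ} (ha : |a| ≤ η) (hb' : |b'| ≤ η)
    (hda : |a - a'| ≤ d) (hdb : |b - b'| ≤ d) : |a * b - a' * b'| ≤ 2 * η * d := by
  have hη : 0 ≤ η := (abs_nonneg a).trans ha
  calc |a * b - a' * b'| = |a * (b - b') + (a - a') * b'| := by ring_nf
    _ ≤ |a| * |b - b'| + |a - a'| * |b'| := by
        rw [← abs_mul, ← abs_mul]; exact abs_add_le _ _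
    _ ≤ η * d + d * η := by gcongr; exact (abs_nonneg _).trans hda
    _ = 2 * η * d := by ring

/-- For each direction `θ`, solve for the complementary component `w`, the multiplier `μ` and the
radial correction `τ` of a point `(1 + τ) • θ + w` on the constraint `⟪K x, x⟫ = 1`. -/
theorem exists_constrained_solution [CompleteSpace H] {K V : H →L[ℝ] H} {G : H → H} {M η δ : ℝ}
    (hM : 1 ≤ M) (hK : ‖K‖ ≤ M) (hV : ‖V‖ ≤ M) (hη : 0 ≤ η) (hηM : M ^ 2 * η ≤ 1 / 8)
    (hδ : 0 ≤ δ) (hδM : M ^ 2 * δ ≤ η / 4) (hG0 : G 0 = 0)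
    (hG : ∀ x y, ‖x‖ ≤ 3 * M → ‖y‖ ≤ 3 * M → ‖G x - G y‖ ≤ δ * ‖x - y‖)
    {S : Set H} (hS : ∀ θ ∈ S, ‖θ‖ ≤ M) :
    ∃ (w : S → H) (μ τ : S → ℝ) (C : ℝ), ∀ θ : S,
      (‖w θ‖ ≤ η ∧ |μ θ| ≤ η ∧ |τ θ| ≤ η) ∧
      V (G ((1 + τ θ) • (θ : H) + w θ) + μ θ • K (w θ)) = w θ ∧
      -⟪G ((1 + τ θ) • (θ : H) + w θ), (θ : H)⟫ - μ θ * τ θ = μ θ ∧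
      -(1 / 2) * (τ θ * τ θ + ⟪K (w θ), w θ⟫) = τ θ ∧
      ∀ θ' : S, ‖w θ - w θ'‖ ≤ C * ‖(θ : H) - θ'‖ ∧ |τ θ - τ θ'| ≤ C * ‖(θ : H) - θ'‖ := by
  have hM0 : 0 ≤ M := by linarith
  have hMM : M ≤ M ^ 2 := by nlinarith
  have hη1 : M * η ≤ 1 / 8 := by nlinarith
  have hη2 : η ≤ 1 / 8 := by nlinarith
  have hδ1 : M * δ ≤ η / 4 := by nlinarith
  have hGn : ∀ x, ‖x‖ ≤ 3 * M → ‖G x‖ ≤ δ * ‖x‖ := fun x hx => by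
    simpa [hG0] using hG x 0 hx (by simpa using hM0)
  let X : S → H × ℝ × ℝ → H := fun θ z => (1 + z.2.2) • (θ : H) + z.1
  let T : S → H × ℝ × ℝ → H × ℝ × ℝ := fun θ z =>
    (V (G (X θ z) + z.2.1 • K z.1), -⟪G (X θ z), (θ : H)⟫ - z.2.1 * z.2.2,
      -(1 / 2) * (z.2.2 * z.2.2 + ⟪K z.1, z.1⟫))
  have hcomp : ∀ {z : H × ℝ × ℝ} {c : ℝ}, ‖z‖ ≤ c ↔ ‖z.1‖ ≤ c ∧ |z.2.1| ≤ c ∧ |z.2.2| ≤ c :=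
    fun {z c} => by rw [norm_prod_le_iff, norm_prod_le_iff, Real.norm_eq_abs, Real.norm_eq_abs]
  have hX : ∀ θ z, ‖z‖ ≤ η → ‖X θ z‖ ≤ 3 * M := fun θ z hz => by
    obtain ⟨h1, -, h3⟩ := hcomp.1 hz
    have hθ := hS θ θ.2
    have h4 : |1 + z.2.2| ≤ 2 := by rw [abs_le] at *; constructor <;> linarith
    calc ‖X θ z‖ ≤ |1 + z.2.2| * ‖(θ : H)‖ + ‖z.1‖ := by
          rw [← Real.norm_eq_abs, ← norm_smul]; exact norm_add_le _ _
      _ ≤ 2 * M + η := by gcongr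
      _ ≤ 3 * M := by linarith
  have hXz : ∀ θ z z', ‖X θ z - X θ z'‖ ≤ 2 * M * ‖z - z'‖ := fun θ z z' => by
    obtain ⟨h1, -, h3⟩ := hcomp.1 (le_refl ‖z - z'‖)
    have hθ := hS θ θ.2
    have : X θ z - X θ z' = (z - z').2.2 • (θ : H) + (z - z').1 := by
      simp only [X, Prod.fst_sub, Prod.snd_sub]; module
    rw [this]
    calc _ ≤ |(z - z').2.2| * ‖(θ : H)‖ + ‖(z - z').1‖ := by
          rw [← Real.norm_eq_abs, ← norm_smul]; exact norm_add_le _ _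
      _ ≤ ‖z - z'‖ * M + ‖z - z'‖ := by gcongr
      _ ≤ 2 * M * ‖z - z'‖ := by nlinarith [norm_nonneg (z - z')]
  have hXθ : ∀ (θ θ' : S) z, ‖z‖ ≤ η → ‖X θ z - X θ' z‖ ≤ 2 * ‖(θ : H) - θ'‖ := fun θ θ' z hz => by
    obtain ⟨-, -, h3⟩ := hcomp.1 hz
    have h4 : |1 + z.2.2| ≤ 2 := by rw [abs_le] at *; constructor <;> linarith
    have : X θ z - X θ' z = (1 + z.2.2) • ((θ : H) - θ') := by simp only [X]; module
    rw [this, norm_smul, Real.norm_eq_abs]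
    gcongr
  have hVle : ∀ y, ‖V y‖ ≤ M * ‖y‖ := fun y => V.le_of_opNorm_le hV y
  have hKle : ∀ y, ‖K y‖ ≤ M * ‖y‖ := fun y => K.le_of_opNorm_le hK y
  have hTz : ∀ θ z z', ‖z‖ ≤ η → ‖z'‖ ≤ η → ‖T θ z - T θ z'‖ ≤ 1 / 2 * ‖z - z'‖ := by
    intro θ z z' hz hz'
    have hGX : ‖G (X θ z) - G (X θ z')‖ ≤ δ * (2 * M * ‖z - z'‖) :=
      (hG _ _ (hX θ z hz) (hX θ z' hz')).trans (by gcongr; exact hXz θ z z')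
    obtain ⟨d1, d2, d3⟩ := hcomp.1 (le_refl ‖z - z'‖)
    obtain ⟨a1, a2, a3⟩ := hcomp.1 hz
    obtain ⟨b1, b2, b3⟩ := hcomp.1 hz'
    have hθ := hS θ θ.2
    set d := ‖z - z'‖ with hd
    have hd0 : 0 ≤ d := norm_nonneg _
    refine hcomp.2 ⟨?_, ?_, ?_⟩
    · have e : (T θ z - T θ z').1 = V ((G (X θ z) - G (X θ z')) +
          (z.2.1 • K (z - z').1 + (z - z').2.1 • K z'.1)) := by
        simp only [T, Prod.fst_sub, Prod.snd_sub, ← map_sub V]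
        congr 1
        rw [map_sub K]
        module
      rw [e]
      calc _ ≤ M * (‖G (X θ z) - G (X θ z')‖ +
            (|z.2.1| * ‖K (z - z').1‖ + |(z - z').2.1| * ‖K z'.1‖)) := by
            refine (hVle _).trans ?_
            gcongr
            refine (norm_add_le _ _).trans ?_
            gcongr
            refine (norm_add_le _ _).trans ?_
            rw [norm_smul, norm_smul, Real.norm_eq_abs, Real.norm_eq_abs]
        _ ≤ M * (δ * (2 * M * d) + (η * (M * d) + d * (M * η))) := by
            gcongr
            · exact (hKle _).trans (by gcongr)
            · exact (hKle _).trans (by gcongr)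
        _ = (2 * (M ^ 2 * δ) + 2 * (M ^ 2 * η)) * d := by ring
        _ ≤ 1 / 2 * d := by gcongr; linarith
    · have e : (T θ z - T θ z').2.1 = -⟪G (X θ z) - G (X θ z'), (θ : H)⟫ -
          (z.2.1 * z.2.2 - z'.2.1 * z'.2.2) := by
        simp only [T, Prod.fst_sub, Prod.snd_sub, inner_sub_left]; ring
      rw [e]
      calc _ ≤ ‖G (X θ z) - G (X θ z')‖ * ‖(θ : H)‖ + |z.2.1 * z.2.2 - z'.2.1 * z'.2.2| := by
            refine (abs_sub _ _).trans ?_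
            rw [abs_neg]
            gcongr
            exact abs_real_inner_le_norm _ _
        _ ≤ δ * (2 * M * d) * M + 2 * η * d := by
            gcongr
            exact abs_mul_sub_mul_le a2 b3 d2 d3
        _ = (2 * (M ^ 2 * δ) + 2 * η) * d := by ring
        _ ≤ 1 / 2 * d := by gcongr; linarith
    · have e : (T θ z - T θ z').2.2 = -(1 / 2) * ((z.2.2 * z.2.2 - z'.2.2 * z'.2.2) +
          (⟪K z.1, (z - z').1⟫ + ⟪K (z - z').1, z'.1⟫)) := by
        simp only [T, Prod.fst_sub, Prod.snd_sub, inner_sub_left, inner_sub_right, map_sub]; ring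
      rw [e, abs_mul]
      calc _ ≤ |-(1 / 2 : ℝ)| * (|z.2.2 * z.2.2 - z'.2.2 * z'.2.2| +
            (‖K z.1‖ * ‖(z - z').1‖ + ‖K (z - z').1‖ * ‖z'.1‖)) := by
            gcongr
            refine (abs_add_le _ _).trans ?_
            gcongr
            refine (abs_add_le _ _).trans ?_
            gcongr <;> exact abs_real_inner_le_norm _ _
        _ ≤ |-(1 / 2 : ℝ)| * (2 * η * d + (M * η * d + M * d * η)) := by
            gcongr
            · exact abs_mul_sub_mul_le a3 b3 d3 d3
            · exact (hKle _).trans (by gcongr)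
            · exact (hKle _).trans (by gcongr)
        _ = (η + M * η) * d := by rw [abs_neg, abs_of_pos (by norm_num)]; ring
        _ ≤ 1 / 2 * d := by gcongr; linarith
  have hT0 : ∀ θ, ‖T θ 0‖ ≤ η / 2 := by
    intro θ
    have hθ := hS θ θ.2
    have hGθ : ‖G θ‖ ≤ δ * M := (hGn _ (by linarith)).trans (by gcongr)
    refine hcomp.2 ⟨?_, ?_, ?_⟩
    · calc ‖(T θ 0).1‖ = ‖V (G θ)‖ := by simp [T, X]
        _ ≤ M * (δ * M) := (hVle _).trans (by gcongr)
        _ ≤ η / 2 := by nlinarith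
    · calc |(T θ 0).2.1| = |⟪G θ, (θ : H)⟫| := by simp [T, X]
        _ ≤ δ * M * M := (abs_real_inner_le_norm _ _).trans (by gcongr)
        _ ≤ η / 2 := by nlinarith
    · simpa [T, X] using (by linarith : 0 ≤ η / 2)
  obtain ⟨C, hTθ⟩ : ∃ C, ∀ (θ θ' : S) z, ‖z‖ ≤ η → ‖T θ z - T θ' z‖ ≤ C * dist θ θ' := by
    refine ⟨5 * M * δ, fun θ θ' z hz => ?_⟩
    rw [Subtype.dist_eq, dist_eq_norm]
    have hGX : ‖G (X θ z) - G (X θ' z)‖ ≤ δ * (2 * ‖(θ : H) - θ'‖) :=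
      (hG _ _ (hX θ z hz) (hX θ' z hz)).trans (by gcongr; exact hXθ θ θ' z hz)
    have hGX' : ‖G (X θ' z)‖ ≤ δ * (3 * M) :=
      (hGn _ (hX θ' z hz)).trans (by gcongr; exact hX θ' z hz)
    have hθ := hS θ θ.2
    set d := ‖(θ : H) - θ'‖
    have hd0 : 0 ≤ d := norm_nonneg _
    have hMδd : 0 ≤ M * δ * d := by positivity
    refine hcomp.2 ⟨?_, ?_, ?_⟩
    · have e : (T θ z - T θ' z).1 = V (G (X θ z) - G (X θ' z)) := by
        simp only [T, Prod.fst_sub, ← map_sub V]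
        congr 1
        abel
      rw [e]
      calc _ ≤ M * (δ * (2 * d)) := (hVle _).trans (by gcongr)
        _ ≤ 5 * M * δ * d := by linarith
    · have e : (T θ z - T θ' z).2.1 =
          -(⟪G (X θ z) - G (X θ' z), (θ : H)⟫ + ⟪G (X θ' z), (θ : H) - θ'⟫) := by
        simp only [T, Prod.fst_sub, Prod.snd_sub, inner_sub_left, inner_sub_right]; ring
      rw [e, abs_neg]
      calc _ ≤ ‖G (X θ z) - G (X θ' z)‖ * ‖(θ : H)‖ + ‖G (X θ' z)‖ * ‖(θ : H) - θ'‖ := by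
            refine (abs_add_le _ _).trans ?_
            gcongr <;> exact abs_real_inner_le_norm _ _
        _ ≤ δ * (2 * d) * M + δ * (3 * M) * d := by gcongr
        _ = 5 * M * δ * d := by ring
    · simp only [T, Prod.snd_sub, sub_self, abs_zero]
      positivity
  obtain ⟨z, hz⟩ := exists_lipschitz_fixedPoint T hη hTz hT0 hTθ
  refine ⟨fun θ => (z θ).1, fun θ => (z θ).2.1, fun θ => (z θ).2.2, 2 * C, fun θ => ?_⟩
  obtain ⟨h1, h2, h3⟩ := hz θ
  refine ⟨hcomp.1 h1, congr($h2.1), congr($h2.2.1), congr($h2.2.2), fun θ' => ?_⟩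
  have h4 := hcomp.1 (h3 θ')
  rw [Subtype.dist_eq, dist_eq_norm] at h4
  exact ⟨h4.1, h4.2.2⟩

/-- A maximizer of `f` along a family of points of the constraint `⟪K x, x⟫ = 1`, parametrized by the
`K`-unit sphere of `ker A`, is a constrained critical point. -/
theorem exists_multiplier [CompleteSpace H] {A K J V : H →L[ℝ] H} {G : H → H} {f : H → ℝ}
    {M η δ : ℝ} (hKsa : IsSelfAdjoint K) (hKpos : ∀ u : H, u ≠ 0 → 0 < ⟪K u, u⟫)
    (hJ : ∀ y, A (J y) = 0) (hJK : ∀ y n, A n = 0 → ⟪K (J y), n⟫ = ⟪y, n⟫)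
    (hVK : ∀ y n, A n = 0 → ⟪K (V y), n⟫ = 0) (hAV : ∀ y, A (V y) = y - K (J y))
    (hM : 1 ≤ M) (hK : ‖K‖ ≤ M) (hV : ‖V‖ ≤ M) (hη : 0 ≤ η) (hηM : M ^ 2 * η ≤ 1 / 8)
    (hδ : 0 ≤ δ) (hδM : M ^ 2 * δ ≤ η / 4) (hG0 : G 0 = 0)
    (hG : ∀ x y, ‖x‖ ≤ 3 * M → ‖y‖ ≤ 3 * M → ‖G x - G y‖ ≤ δ * ‖x - y‖)
    (hSc : IsCompact {θ : H | A θ = 0 ∧ ⟪K θ, θ⟫ = 1})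
    (hSne : {θ : H | A θ = 0 ∧ ⟪K θ, θ⟫ = 1}.Nonempty)
    (hS : ∀ θ : H, A θ = 0 → ⟪K θ, θ⟫ = 1 → ‖θ‖ ≤ M)
    (hf : ∀ x, HasFDerivAt f (innerSL ℝ (A x - G x)) x) :
    ∃ (x : H) (μ : ℝ), x ≠ 0 ∧ ‖x‖ ≤ 3 * M ∧ |μ| ≤ η ∧ A x - G x = μ • K x := by
  set S := {θ : H | A θ = 0 ∧ ⟪K θ, θ⟫ = 1}
  have hsymm : ∀ x y, ⟪K x, y⟫ = ⟪K y, x⟫ := fun x y => by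
    rw [real_inner_comm]; exact (hKsa.isSymmetric y x).symm
  obtain ⟨w, μ, τ, C, h⟩ := exists_constrained_solution hM hK hV hη hηM hδ hδM hG0 hG (S := S)
    (fun θ hθ => hS θ hθ.1 hθ.2)
  let x : S → H := fun θ => (1 + τ θ) • (θ : H) + w θ
  have hwK : ∀ θ n, A n = 0 → ⟪K (w θ), n⟫ = 0 := fun θ n hn => by
    rw [← (h θ).2.1]; exact hVK _ n hn
  have hxK : ∀ θ, ⟪K (x θ), x θ⟫ = 1 := fun θ => by
    have h1 := hwK θ θ θ.2.1
    have h2 := (h θ).2.2.2.1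
    have h3 := θ.2.2
    simp only [x, map_add, map_smul, inner_add_left, inner_add_right, inner_smul_left,
      inner_smul_right, conj_trivial, hsymm θ (w θ), h1, h3]
    linarith
  have hwc : Continuous w :=
    (LipschitzWith.of_dist_le_mul (K := C.toNNReal) fun θ θ' => by
      rw [dist_eq_norm, Subtype.dist_eq, dist_eq_norm]
      exact ((h θ).2.2.2.2 θ').1.trans (by gcongr; exact Real.le_coe_toNNReal C)).continuous
  have hτc : Continuous τ :=
    (LipschitzWith.of_dist_le_mul (K := C.toNNReal) fun θ θ' => by
      rw [dist_eq_norm, Subtype.dist_eq, dist_eq_norm]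
      exact ((h θ).2.2.2.2 θ').2.trans (by gcongr; exact Real.le_coe_toNNReal C)).continuous
  have hxc : Continuous x := by fun_prop
  have hfc : Continuous f := continuous_iff_continuousAt.2 fun y => (hf y).continuousAt
  have : CompactSpace S := isCompact_iff_compactSpace.1 hSc
  have : Nonempty S := hSne.to_subtype
  obtain ⟨θ₀, -, hmax⟩ := isCompact_univ.exists_isMaxOn Set.univ_nonempty
    (hfc.comp hxc).continuousOn
  obtain ⟨⟨hw, hμ, hτ⟩, hweq, hμeq, -, hlip⟩ := h θ₀
  have hθ₀ := hS θ₀ θ₀.2.1 θ₀.2.2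
  have hηs : η ≤ 1 / 8 := by nlinarith [one_le_pow₀ hM (n := 2)]
  have hx3 : ‖x θ₀‖ ≤ 3 * M := by
    have h4 : |1 + τ θ₀| ≤ 2 := by rw [abs_le] at *; constructor <;> linarith
    calc ‖x θ₀‖ ≤ |1 + τ θ₀| * ‖(θ₀ : H)‖ + ‖w θ₀‖ := by
          rw [← Real.norm_eq_abs, ← norm_smul]; exact norm_add_le _ _
      _ ≤ 2 * M + η := by gcongr
      _ ≤ 3 * M := by linarith
  have ht₀ : 0 < 1 + τ θ₀ := by rw [abs_le] at hτ; linarith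
  refine ⟨x θ₀, μ θ₀, fun h0 => by simpa [h0] using hxK θ₀, hx3, hμ, ?_⟩
  set E := A (x θ₀) - G (x θ₀) - μ θ₀ • K (x θ₀) with hE
  suffices E = 0 from sub_eq_zero.1 this
  set Y := G (x θ₀) + μ θ₀ • K (w θ₀) with hY
  set m := J Y + (μ θ₀ * (1 + τ θ₀)) • (θ₀ : H) with hm
  have hAm : A m = 0 := by simp [hm, hJ, θ₀.2.1]
  have hEm : E = -K m := by
    have hAx : A (x θ₀) = Y - K (J Y) := by
      rw [← hAV, hweq]; simp [x, θ₀.2.1]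
    have hGx : G (x θ₀) = Y - μ θ₀ • K (w θ₀) := by rw [hY]; abel
    have hKx : K (x θ₀) = (1 + τ θ₀) • K θ₀ + K (w θ₀) := by simp [x]
    rw [hE, hAx, hGx, hKx, hm, map_add K, map_smul K]
    module
  have hEθ : ⟪E, (θ₀ : H)⟫ = 0 := by
    rw [hEm, hm, inner_neg_left, map_add, map_smul, inner_add_left, inner_smul_left,
      hJK _ _ θ₀.2.1, θ₀.2.2, hY, inner_add_left, inner_smul_left, hwK _ _ θ₀.2.1]
    simp only [conj_trivial]
    linarith
  have hEw : ∀ θ, ⟪E, w θ⟫ = 0 := fun θ => by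
    rw [hEm, inner_neg_left, hsymm, hwK θ m hAm, neg_zero]
  have hEξ : ∀ ξ, A ξ = 0 → ⟪K ξ, (θ₀ : H)⟫ = 0 → ⟪E, ξ⟫ = 0 := by
    intro ξ hξ hξθ
    have hq : 0 ≤ ⟪K ξ, ξ⟫ := by
      rcases eq_or_ne ξ 0 with rfl | hne
      · simp
      · exact (hKpos ξ hne).le
    set q := ⟪K ξ, ξ⟫ with hq'
    let a : ℝ → ℝ := fun s => (√(1 + s ^ 2 * q))⁻¹
    have hpos : ∀ s : ℝ, 0 < 1 + s ^ 2 * q := fun s => by positivity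
    have ha : ∀ s, a s ^ 2 * (1 + s ^ 2 * q) = 1 := fun s => by
      simp only [a, inv_pow, Real.sq_sqrt (hpos s).le]
      exact inv_mul_cancel₀ (hpos s).ne'
    have had : Differentiable ℝ a := fun s =>
      DifferentiableAt.inv (DifferentiableAt.sqrt (by fun_prop) (hpos s).ne')
        (Real.sqrt_pos.2 (hpos s)).ne'
    let γ : ℝ → H := fun s => a s • ((θ₀ : H) + s • ξ)
    have hγS : ∀ s, γ s ∈ S := fun s => by
      refine ⟨by simp [γ, hξ, θ₀.2.1], ?_⟩
      simp only [γ, map_add, map_smul, inner_add_left, inner_add_right, inner_smul_left,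
        inner_smul_right, conj_trivial, hsymm θ₀ ξ, hξθ, θ₀.2.2, ← hq']
      linarith [ha s]
    let p : ℝ → S := fun s => ⟨γ s, hγS s⟩
    have hp0 : p 0 = θ₀ := Subtype.ext (by simp [p, γ, a])
    have hγd : Differentiable ℝ γ := by fun_prop
    have hpc : Continuous p := hγd.continuous.subtype_mk _
    have hγO : (fun s => γ s - θ₀) =O[𝓝 0] fun s : ℝ => s := by
      have := (hγd 0).isBigO_sub
      have h0 : γ 0 = θ₀ := congr_arg Subtype.val hp0
      simpa [h0] using this
    have hxO : (fun s => x (p s) - x θ₀) =O[𝓝 0] fun s : ℝ => s := by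
      have hwO : (fun s => w (p s) - w θ₀) =O[𝓝 0] fun s => γ s - θ₀ :=
        Asymptotics.IsBigO.of_bound C (Eventually.of_forall fun s => by
          have := (hlip (p s)).1
          rwa [norm_sub_rev, norm_sub_rev (θ₀ : H)] at this)
      have hτO : (fun s => τ (p s) - τ θ₀) =O[𝓝 0] fun s => γ s - θ₀ :=
        Asymptotics.IsBigO.of_bound C (Eventually.of_forall fun s => by
          have := (hlip (p s)).2
          rwa [abs_sub_comm, norm_sub_rev (θ₀ : H)] at this)
      have h1 : (fun s => (1 + τ (p s)) • (γ s - θ₀)) =O[𝓝 0] fun s : ℝ => s := by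
        have hb : (fun s => 1 + τ (p s)) =O[𝓝 0] fun _ : ℝ => (1 : ℝ) :=
          Tendsto.isBigO_one ℝ (ContinuousAt.tendsto (by fun_prop))
        simpa using hb.smul hγO
      have h2 : (fun s => (τ (p s) - τ θ₀) • (θ₀ : H)) =O[𝓝 0] fun s : ℝ => s := by
        simpa using (hτO.trans hγO).smul (Asymptotics.isBigO_const_one ℝ (θ₀ : H) (𝓝 (0 : ℝ)))
      refine ((h1.add h2).add (hwO.trans hγO)).congr_left fun s => ?_
      simp only [x, p]
      module
    let F : H → ℝ := fun y => f y - μ θ₀ / 2 * ⟪K y, y⟫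
    have hF : HasFDerivAt F (innerSL ℝ E) (x θ₀) := by
      have h1 := (K.hasFDerivAt (x := x θ₀)).inner ℝ (hasFDerivAt_id (x θ₀))
      refine ((hf (x θ₀)).sub (h1.const_mul (μ θ₀ / 2))).congr_fderiv ?_
      ext v
      simp only [hE, sub_apply, smul_apply, ContinuousLinearMap.comp_apply,
        ContinuousLinearMap.prod_apply, fderivInnerCLM_apply, innerSL_apply_apply, inner_sub_left,
        inner_smul_left, hsymm v, id, ContinuousLinearMap.id_apply, conj_trivial, smul_eq_mul]
      ring
    have hderiv : HasDerivAt (fun s => F (x (p s))) ((1 + τ θ₀) * ⟪E, ξ⟫) 0 := by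
      have hxt : Tendsto (fun s => x (p s)) (𝓝 0) (𝓝 (x θ₀)) := by
        have : ContinuousAt (fun s => x (p s)) 0 := by fun_prop
        simpa [ContinuousAt, hp0] using this
      have h1 := (hF.isLittleO.comp_tendsto hxt).trans_isBigO hxO
      have h2 : (fun s : ℝ => (((1 + τ (p s)) * a s - (1 + τ θ₀)) * ⟪E, ξ⟫) * s) =o[𝓝 0]
          fun s : ℝ => s := by
        have ht : Tendsto (fun s => ((1 + τ (p s)) * a s - (1 + τ θ₀)) * ⟪E, ξ⟫) (𝓝 0) (𝓝 0) := by
          have hac := had.continuous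
          have : ContinuousAt (fun s => ((1 + τ (p s)) * a s - (1 + τ θ₀)) * ⟪E, ξ⟫) 0 := by
            fun_prop
          simpa [ContinuousAt, hp0, a] using this
        simpa using ((Asymptotics.isLittleO_one_iff ℝ).2 ht).mul_isBigO
          (Asymptotics.isBigO_refl (fun s : ℝ => s) (𝓝 0))
      rw [hasDerivAt_iff_isLittleO]
      refine (h1.add h2).congr (fun s => ?_) fun s => by simp
      have h3 : ⟪E, x (p s) - x θ₀⟫ = (1 + τ (p s)) * a s * ⟪E, ξ⟫ * s := by
        simp only [x, p, γ, inner_sub_right, inner_add_right, inner_smul_right, hEθ, hEw]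
        ring
      simp only [Function.comp, innerSL_apply_apply, h3, hp0, smul_eq_mul, sub_zero]
      ring
    have hloc : IsLocalMax (fun s => F (x (p s))) 0 := Eventually.of_forall fun s => by
      have := hmax (Set.mem_univ (p s))
      simp only [F, hxK, hp0]
      simpa using this
    exact (mul_eq_zero.1 (hloc.hasDerivAt_eq_zero hderiv)).resolve_left ht₀.ne'
  have hEn : ∀ n, A n = 0 → ⟪E, n⟫ = 0 := fun n hn => by
    have := hEξ (n - ⟪K n, (θ₀ : H)⟫ • (θ₀ : H)) (by simp [hn, θ₀.2.1])
      (by simp [inner_sub_left, inner_smul_left, θ₀.2.2])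
    simpa [inner_sub_right, inner_smul_right, hEθ] using this
  have hm0 : m = 0 := by
    by_contra hne
    have := hEn m hAm
    rw [hEm, inner_neg_left] at this
    linarith [hKpos m hne]
  rw [hEm, hm0]; simp

end Reduction

section Bifurcation

variable {H : Type*} [NormedAddCommGroup H] [InnerProductSpace ℝ H] [CompleteSpace H]

/-- A `C¹` map with vanishing derivative at the origin has arbitrarily small Lipschitz constants on
small balls. -/
theorem exists_lipschitz_closedBall {E F : Type*} [NormedAddCommGroup E] [NormedSpace ℝ E]
    [NormedAddCommGroup F] [NormedSpace ℝ F] {G : E → F} (hG : ContDiffAt ℝ 1 G 0)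
    (hG' : HasFDerivAt G (0 : E →L[ℝ] F) 0) {δ : ℝ} (hδ : 0 < δ) :
    ∃ ρ > 0, ∀ x y, ‖x‖ ≤ ρ → ‖y‖ ≤ ρ → ‖G x - G y‖ ≤ δ * ‖x - y‖ := by
  lift δ to NNReal using hδ.le
  have hstrict := hG.hasStrictFDerivAt' hG' one_ne_zero
  obtain ⟨s, hs, hlip⟩ := hstrict.exists_lipschitzOnWith_of_nnnorm_lt δ (by simpa using hδ)
  obtain ⟨ρ, hρ, hsub⟩ := Metric.nhds_basis_closedBall.mem_iff.1 hs
  refine ⟨ρ, hρ, fun x y hx hy => ?_⟩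
  simpa only [dist_eq_norm] using hlip.dist_le_mul x (hsub (by simpa using hx)) y
    (hsub (by simpa using hy))

theorem contDiff_nonlinearity {f : H → ℝ} (hf : ContDiff ℝ 2 f) {A : H →L[ℝ] H} {G : H → H}
    (hgrad : ∀ u φ, fderiv ℝ f u φ = ⟪A u - G u, φ⟫) : ContDiff ℝ 1 G := by
  have h1 : ContDiff ℝ 1 (fderiv ℝ f) := hf.fderiv_right (by norm_num)
  have h2 : G = fun u => A u - (InnerProductSpace.toDual ℝ H).symm (fderiv ℝ f u) := by
    funext u
    have : fderiv ℝ f u = InnerProductSpace.toDual ℝ H (A u - G u) := by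
      ext φ; rw [hgrad, InnerProductSpace.toDual_apply_apply]
    rw [this, LinearIsometryEquiv.symm_apply_apply]
    abel
  rw [h2]
  exact A.contDiff.sub
    ((InnerProductSpace.toDual ℝ H).symm.toContinuousLinearEquiv.contDiff.comp h1)

/-- Arbitrarily close to the origin there are nontrivial solutions of
`(L - lam • K) u - G u = μ • K u` with arbitrarily small `μ`. -/
theorem exists_small_solution {L L' K : H →L[ℝ] H} {G : H → H} {f : H → ℝ} {lam : ℝ}
    (hLsa : IsSelfAdjoint L) (hKsa : IsSelfAdjoint K)
    (hL' : L' ∘L L = ContinuousLinearMap.id ℝ H) (hLL' : L ∘L L' = ContinuousLinearMap.id ℝ H)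
    (hK : IsCompactOperator K) (hKpos : ∀ u : H, u ≠ 0 → 0 < ⟪K u, u⟫)
    (hf : ContDiff ℝ 2 f) (hgrad : ∀ u φ, fderiv ℝ f u φ = ⟪(L - lam • K) u - G u, φ⟫)
    (hG0 : G 0 = 0) (hG' : HasFDerivAt G (0 : H →L[ℝ] H) 0)
    (hker : ∃ u, u ≠ 0 ∧ (L - lam • K) u = 0) {ε : ℝ} (hε : 0 < ε) :
    ∃ (u : H) (μ : ℝ), u ≠ 0 ∧ ‖u‖ ≤ ε ∧ |μ| ≤ ε ∧ (L - lam • K) u - G u = μ • K u := by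
  set A := L - lam • K with hA
  have hfd : FiniteDimensional ℝ (LinearMap.ker A.toLinearMap) :=
    finiteDimensional_ker_sub_smul hL' hK lam
  obtain ⟨J, hJ, hJK⟩ := exists_compression_inverse hKpos (LinearMap.ker A.toLinearMap)
  obtain ⟨V, hVK, hAV⟩ := exists_solution_operator hLsa hKsa hLL' hK hKpos lam hJ hJK
  have hSc := isCompact_unit_sphere_of_positive hKpos (LinearMap.ker A.toLinearMap)
  obtain ⟨R, hR⟩ := hSc.isBounded.exists_norm_le
  have hSne : {θ : H | A θ = 0 ∧ ⟪K θ, θ⟫ = 1}.Nonempty := by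
    obtain ⟨u, hu, hAu⟩ := hker
    have hpos := hKpos u hu
    refine ⟨(√⟪K u, u⟫)⁻¹ • u, by simp [hAu], ?_⟩
    have h2 := Real.sq_sqrt hpos.le
    have h3 := (Real.sqrt_pos.2 hpos).ne'
    simp only [map_smul, inner_smul_left, inner_smul_right, conj_trivial]
    field_simp
    linarith
  obtain ⟨M, hM, hMK, hMV, hMR⟩ : ∃ M : ℝ, 1 ≤ M ∧ ‖K‖ ≤ M ∧ ‖V‖ ≤ M ∧ R ≤ M :=
    ⟨max (max 1 ‖K‖) (max ‖V‖ R), by simp, by simp, by simp, by simp⟩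
  have hM0 : 0 < M := by linarith
  set η := min ε (1 / 8 / M ^ 2) with hη
  have hη0 : 0 < η := by positivity
  have hηM : M ^ 2 * η ≤ 1 / 8 := by
    rw [mul_comm, ← le_div_iff₀ (by positivity)]; exact min_le_right _ _
  set δ := η / 4 / M ^ 2 with hδ
  have hδ0 : 0 < δ := by positivity
  have hδM : M ^ 2 * δ ≤ η / 4 := by rw [hδ]; field_simp; rfl
  obtain ⟨ρ, hρ, hlip⟩ := exists_lipschitz_closedBall
    (contDiff_nonlinearity hf hgrad).contDiffAt hG' hδ0
  set r := min ρ ε / (3 * M) with hr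
  have hr0 : 0 < r := by positivity
  have hrM : ∀ x : H, ‖x‖ ≤ 3 * M → ‖r • x‖ ≤ min ρ ε := fun x hx => by
    rw [norm_smul, Real.norm_of_nonneg hr0.le, hr]
    calc _ ≤ min ρ ε / (3 * M) * (3 * M) := by gcongr
      _ = min ρ ε := by field_simp
  obtain ⟨x, μ, hx0, hx, hμ, heq⟩ := exists_multiplier (A := A) (K := K) (J := J) (V := V)
    (G := fun x => r⁻¹ • G (r • x)) (f := fun x => (r ^ 2)⁻¹ * f (r • x)) hKsa hKpos hJ hJK hVK hAV
    hM hMK hMV hη0.le hηM hδ0.le hδM (by simp [hG0])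
    (fun x y hx hy => by
      have h := hlip (r • x) (r • y) ((hrM x hx).trans (min_le_left _ _))
        ((hrM y hy).trans (min_le_left _ _))
      rw [← smul_sub, norm_smul, Real.norm_of_nonneg hr0.le] at h
      rw [← smul_sub, norm_smul, Real.norm_of_nonneg (by positivity), inv_mul_le_iff₀ hr0]
      linarith)
    hSc hSne (fun θ h1 h2 => (hR θ ⟨h1, h2⟩).trans hMR)
    (fun x => by
      have hd : HasFDerivAt f (fderiv ℝ f (r • x)) (r • x) :=
        (hf.differentiable (by norm_num) _).hasFDerivAt
      have h1 := (hd.comp x ((hasFDerivAt_id x).const_smul r)).const_mul ((r ^ 2)⁻¹)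
      refine h1.congr_fderiv ?_
      ext φ
      simp only [smul_apply, ContinuousLinearMap.comp_apply, ContinuousLinearMap.id_apply, hgrad,
        innerSL_apply_apply, inner_sub_left, map_smul, inner_smul_left, smul_eq_mul, conj_trivial,
        inner_smul_right]
      field_simp)
  refine ⟨r • x, μ, smul_ne_zero hr0.ne' hx0, (hrM x hx).trans (min_le_right _ _),
    hμ.trans (min_le_left _ _), ?_⟩
  have h := congr(r • $heq)
  rw [smul_sub, smul_inv_smul₀ hr0.ne'] at h
  rw [map_smul, map_smul, h, smul_comm]

end Bifurcation

/-- variational bifurcation theorem (Theorem 4.1 of the paper). If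
`∇Ψ_λ(u) = Lu - λKu - G(u)` with `L` self-adjoint invertible, `K` compact self-adjoint
positive, `G(0) = 0`, `G'(0) = 0`, then every `λ⋆` with `ker(L - λ⋆ K) ≠ {0}` is a
bifurcation point for `∇Ψ_λ(u) = 0`. -/
theorem stmt_5 {H : Type*} [NormedAddCommGroup H] [InnerProductSpace ℝ H] [CompleteSpace H]
    [TopologicalSpace.SeparableSpace H]
    (Ψ : H × ℝ → ℝ) (hΨ : ContDiff ℝ 2 Ψ)
    (L K : H →L[ℝ] H) (G : H → H)
    (hgrad : ∀ (u : H) (lam : ℝ) (φ : H),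
      fderiv ℝ (fun v => Ψ (v, lam)) u φ = ⟪L u - lam • K u - G u, φ⟫)
    (hLsa : IsSelfAdjoint L)
    (hLinv : ∃ L' : H →L[ℝ] H,
      L' ∘L L = ContinuousLinearMap.id ℝ H ∧ L ∘L L' = ContinuousLinearMap.id ℝ H)
    (hKcomp : IsCompactOperator (⇑K)) (hKsa : IsSelfAdjoint K)
    (hKpos : ∀ u : H, u ≠ 0 → 0 < ⟪K u, u⟫)
    (hG0 : G 0 = 0) (hG'0 : HasFDerivAt G (0 : H →L[ℝ] H) 0)
    (lamStar : ℝ) (hker : ∃ u : H, u ≠ 0 ∧ L u = lamStar • K u) :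
    ∃ (u : ℕ → H) (lam : ℕ → ℝ),
      (∀ n : ℕ, u n ≠ 0) ∧
      (∀ n : ℕ, L (u n) - lam n • K (u n) - G (u n) = 0) ∧
      Tendsto u atTop (𝓝 (0 : H)) ∧ Tendsto lam atTop (𝓝 lamStar) := by
  obtain ⟨L', hL', hLL'⟩ := hLinv
  have hf : ContDiff ℝ 2 fun v => Ψ (v, lamStar) := hΨ.comp (contDiff_id.prodMk contDiff_const)
  have hker' : ∃ u, u ≠ 0 ∧ (L - lamStar • K) u = 0 := by
    obtain ⟨u, hu, h⟩ := hker
    exact ⟨u, hu, by simp [h]⟩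
  choose u μ hu hun hμ heq using fun n : ℕ => exists_small_solution hLsa hKsa hL' hLL' hKcomp hKpos
    hf (fun u φ => by simpa using hgrad u lamStar φ) hG0 hG'0 hker' (ε := 1 / ((n : ℝ) + 1))
    (by positivity)
  have hlim := tendsto_one_div_add_atTop_nhds_zero_nat (𝕜 := ℝ)
  refine ⟨u, fun n => lamStar + μ n, hu, fun n => ?_, squeeze_zero_norm hun hlim, ?_⟩
  · have h : L (u n) - lamStar • K (u n) - G (u n) = μ n • K (u n) := by simpa using heq n
    have h2 : L (u n) - (lamStar + μ n) • K (u n) - G (u n) =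
        (L (u n) - lamStar • K (u n) - G (u n)) - μ n • K (u n) := by module
    rw [h2, h, sub_self]
  · simpa using (squeeze_zero_norm hμ hlim).const_add lamStar
end

section
/- Let a₋ < 0 < a₊, σ₋ < 0 < σ₊, and c₋, c₊ > 0 be real constants, and set k₋ := √(c₋/(−σ₋)), k₊ := √(c₊/σ₊). Then for every integer j ≥ 1 there exists exactly one real number τ in the open interval ( jπ/(k₊ a₊), (2j+1)π/(2 k₊ a₊) ) satisfying σ₋ k₋ tan(τ k₊ a₊) = σ₊ k₊ tanh(τ k₋ a₋). -/
open Real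

theorem strictMonoOn_tan_div_self :
    StrictMonoOn (fun x : ℝ => Real.tan x / x) (Set.Ioo 0 (π / 2)) := by
  have hd : ∀ x ∈ Set.Ioo (0 : ℝ) (π / 2), HasDerivAt (fun x : ℝ => Real.tan x / x)
      ((1 / Real.cos x ^ 2 * x - Real.tan x * 1) / x ^ 2) x := fun x hx =>
    (Real.hasDerivAt_tan (Real.cos_pos_of_mem_Ioo ⟨by linarith [hx.1, Real.pi_pos], hx.2⟩).ne').div
      (hasDerivAt_id x) hx.1.ne'
  refine strictMonoOn_of_deriv_pos (convex_Ioo _ _)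
    (fun x hx => (hd x hx).continuousAt.continuousWithinAt) fun x hx => ?_
  rw [interior_Ioo] at hx
  rw [(hd x hx).deriv]
  have hc : 0 < Real.cos x :=
    Real.cos_pos_of_mem_Ioo ⟨by linarith [hx.1, Real.pi_pos], hx.2⟩
  have hs : Real.sin x * Real.cos x < x := by
    nlinarith [Real.sin_lt hx.1, Real.cos_le_one x,
      Real.sin_pos_of_pos_of_lt_pi hx.1 (by linarith [hx.2, Real.pi_pos])]
  refine div_pos ?_ (pow_pos hx.1 2)
  rw [Real.tan_eq_sin_div_cos,
    show 1 / Real.cos x ^ 2 * x - Real.sin x / Real.cos x * 1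
      = (x - Real.sin x * Real.cos x) / Real.cos x ^ 2 by field_simp]
  exact div_pos (sub_pos.2 hs) (pow_pos hc 2)

theorem hasDerivAt_real_tanh (x : ℝ) : HasDerivAt Real.tanh (1 / Real.cosh x ^ 2) x := by
  have h := (Real.hasDerivAt_sinh x).div (Real.hasDerivAt_cosh x) (Real.cosh_pos x).ne'
  rw [show Real.cosh x * Real.cosh x - Real.sinh x * Real.sinh x = 1 by
    linarith [Real.cosh_sq x]] at h
  exact h.congr_of_eventuallyEq (.of_forall Real.tanh_eq_sinh_div_cosh)

theorem antitoneOn_tanh_div_self :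
    AntitoneOn (fun x : ℝ => Real.tanh x / x) (Set.Ioi 0) := by
  have hd : ∀ x ∈ Set.Ioi (0 : ℝ), HasDerivAt (fun x : ℝ => Real.tanh x / x)
      ((1 / Real.cosh x ^ 2 * x - Real.tanh x * 1) / x ^ 2) x := fun x hx =>
    (hasDerivAt_real_tanh x).div (hasDerivAt_id x) (ne_of_gt hx)
  refine antitoneOn_of_deriv_nonpos (convex_Ioi _)
    (fun x hx => (hd x hx).continuousAt.continuousWithinAt)
    (fun x hx => (hd x (interior_subset hx)).differentiableAt.differentiableWithinAt)
    fun x hx => ?_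
  rw [interior_Ioi] at hx
  rw [(hd x hx).deriv]
  have hx' : 0 < x := hx
  have hs : x ≤ Real.sinh x * Real.cosh x := by
    nlinarith [Real.self_lt_sinh_iff.2 hx', Real.one_le_cosh x]
  refine div_nonpos_of_nonpos_of_nonneg ?_ (sq_nonneg x)
  have hc := Real.cosh_pos x
  rw [Real.tanh_eq_sinh_div_cosh,
    show 1 / Real.cosh x ^ 2 * x - Real.sinh x / Real.cosh x * 1
      = (x - Real.sinh x * Real.cosh x) / Real.cosh x ^ 2 by field_simp]
  exact div_nonpos_of_nonpos_of_nonneg (sub_nonpos.2 hs) (sq_nonneg _)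

theorem tanh_pos_of_pos {x : ℝ} (hx : 0 < x) : 0 < Real.tanh x := by
  rw [Real.tanh_eq_sinh_div_cosh]
  exact div_pos (Real.sinh_pos_iff.2 hx) (Real.cosh_pos x)

theorem existsUnique_tan_eq_mul_tanh {A C p : ℝ} (hA : 0 < A) (hC : 0 < C) (hp : 0 < p) :
    ∃! x : ℝ, x ∈ Set.Ioo 0 (π / 2) ∧ Real.tan x = A * Real.tanh (C * (x + p)) := by
  refine existsUnique_of_exists_of_unique ?_ ?_
  · have hcont : Continuous fun x : ℝ => Real.arctan (A * Real.tanh (C * (x + p))) - x := by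
      have : Continuous Real.tanh :=
        continuous_iff_continuousAt.2 fun x => (hasDerivAt_real_tanh x).continuousAt
      fun_prop
    have h0 : 0 < Real.arctan (A * Real.tanh (C * (0 + p))) - 0 := by
      rw [sub_zero, Real.arctan_pos]
      exact mul_pos hA (tanh_pos_of_pos (by positivity))
    have h1 : Real.arctan (A * Real.tanh (C * (π / 2 + p))) - π / 2 < 0 :=
      sub_neg.2 (Real.arctan_lt_pi_div_two _)
    obtain ⟨x, hx, hx0⟩ :=
      intermediate_value_Ioo' Real.pi_div_two_pos.le hcont.continuousOn ⟨h1, h0⟩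
    refine ⟨x, hx, ?_⟩
    rw [← Real.tan_arctan (A * Real.tanh (C * (x + p))), sub_eq_zero.1 hx0]
  · have key : ∀ x y : ℝ, x ∈ Set.Ioo 0 (π / 2) → y ∈ Set.Ioo 0 (π / 2) →
        Real.tan x = A * Real.tanh (C * (x + p)) →
        Real.tan y = A * Real.tanh (C * (y + p)) → ¬ x < y := by
      intro x y hx hy ex ey hxy
      have hx0 := hx.1
      have hy0 := hy.1
      have h1 : Real.tan x / x < Real.tan y / y := strictMonoOn_tan_div_self hx hy hxy
      have h2 : Real.tanh (C * (y + p)) / (C * (y + p)) ≤ Real.tanh (C * (x + p)) / (C * (x + p)) :=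
        antitoneOn_tanh_div_self (Set.mem_Ioi.2 (by positivity)) (Set.mem_Ioi.2 (by positivity))
          (by gcongr)
      have hT : 0 < Real.tanh (C * (x + p)) := tanh_pos_of_pos (by positivity)
      have h3 : (y + p) / y ≤ (x + p) / x := by
        rw [div_le_div_iff₀ hy0 hx0]
        nlinarith
      have h4 := mul_le_mul h2 h3 (by positivity) (by positivity)
      rw [ex, ey] at h1
      refine absurd h1 (not_lt.2 ?_)
      calc A * Real.tanh (C * (y + p)) / y
          = A * C * (Real.tanh (C * (y + p)) / (C * (y + p)) * ((y + p) / y)) := by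
            field_simp
        _ ≤ A * C * (Real.tanh (C * (x + p)) / (C * (x + p)) * ((x + p) / x)) := by gcongr
        _ = A * Real.tanh (C * (x + p)) / x := by field_simp
    rintro x y ⟨hx, ex⟩ ⟨hy, ey⟩
    exact le_antisymm (not_lt.1 (key y x hy hx ey ex)) (not_lt.1 (key x y hx hy ex ey))

/-- Lemma 4.4 (i): for every `j ≥ 1` there is exactly one `τ` in the
interval `(jπ/(k₊a₊), (2j+1)π/(2k₊a₊))` with
`σ₋ k₋ tan(τ k₊ a₊) = σ₊ k₊ tanh(τ k₋ a₋)`. -/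
theorem stmt_8 (am ap σm σp cm cp km kp : ℝ)
    (ham : am < 0) (hap : 0 < ap) (hσm : σm < 0) (hσp : 0 < σp)
    (hcm : 0 < cm) (hcp : 0 < cp)
    (hkm : km = Real.sqrt (cm / (-σm))) (hkp : kp = Real.sqrt (cp / σp)) :
    ∀ j : ℕ, 1 ≤ j →
      ∃! τ : ℝ,
        τ ∈ Set.Ioo ((j * π) / (kp * ap)) (((2 * j + 1) * π) / (2 * kp * ap)) ∧
        σm * km * Real.tan (τ * kp * ap) = σp * kp * Real.tanh (τ * km * am) := by
  intro j hj
  have hkm0 : 0 < km := hkm ▸ Real.sqrt_pos.2 (div_pos hcm (neg_pos.2 hσm))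
  have hkp0 : 0 < kp := hkp ▸ Real.sqrt_pos.2 (div_pos hcp hσp)
  have hj0 : (0 : ℝ) < j := by exact_mod_cast hj
  have hK : 0 < kp * ap := mul_pos hkp0 hap
  have hD : 0 < -σm * km := mul_pos (neg_pos.2 hσm) hkm0
  have hC : 0 < km * -am / (kp * ap) := div_pos (mul_pos hkm0 (neg_pos.2 ham)) hK
  have hA : 0 < σp * kp / (-σm * km) := div_pos (mul_pos hσp hkp0) hD
  have hiff : ∀ τ : ℝ,
      (τ ∈ Set.Ioo ((j * π) / (kp * ap)) (((2 * j + 1) * π) / (2 * kp * ap)) ∧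
        σm * km * Real.tan (τ * kp * ap) = σp * kp * Real.tanh (τ * km * am)) ↔
      (τ * (kp * ap) - j * π ∈ Set.Ioo 0 (π / 2) ∧
        Real.tan (τ * (kp * ap) - j * π) = σp * kp / (-σm * km) *
          Real.tanh (km * -am / (kp * ap) * (τ * (kp * ap) - j * π + j * π))) := by
    intro τ
    refine and_congr ?_ ?_
    · rw [Set.mem_Ioo, Set.mem_Ioo, div_lt_iff₀ hK, lt_div_iff₀ (by positivity)]
      constructor <;> rintro ⟨h1, h2⟩ <;> constructor <;> linarith
    · have e : km * -am / (kp * ap) * (τ * (kp * ap) - j * π + j * π) = -(τ * km * am) := by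
        field_simp
        ring
      rw [e, Real.tanh_neg, Real.tan_sub_nat_mul_pi, ← mul_assoc τ, div_mul_eq_mul_div,
        eq_div_iff hD.ne']
      constructor <;> intro h <;> linarith
  obtain ⟨x, hx, hu⟩ := existsUnique_tan_eq_mul_tanh hA hC (mul_pos hj0 Real.pi_pos)
  have hinv : (x + j * π) / (kp * ap) * (kp * ap) - j * π = x := by
    rw [div_mul_cancel₀ _ hK.ne', add_sub_cancel_right]
  refine ⟨(x + j * π) / (kp * ap), (hiff _).2 (by rw [hinv]; exact hx), fun τ hτ => ?_⟩
  rw [eq_div_iff hK.ne', ← hu _ ((hiff τ).1 hτ), sub_add_cancel]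
end

section
/- Let a₋ < 0 < a₊, σ₋ < 0 < σ₊, and c₋, c₊ > 0 be real constants, and set k₋ := √(c₋/(−σ₋)), k₊ := √(c₊/σ₊). Then for every integer m ≥ 1 there exists exactly one real number τ in the open interval ( mπ/(k₋ |a₋|), (2m+1)π/(2 k₋ |a₋|) ) satisfying σ₊ k₊ tan(τ k₋ a₋) = σ₋ k₋ tanh(τ k₊ a₊). -/
open Real

theorem hasDerivAt_arctan_mul_tanh (r t : ℝ) :
    HasDerivAt (fun s => arctan (r * Real.tanh s))
      (r / (Real.cosh t ^ 2 + r ^ 2 * Real.sinh t ^ 2)) t := by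
  have hc : 0 < Real.cosh t := Real.cosh_pos t
  have htanh : HasDerivAt Real.tanh
      ((Real.cosh t * Real.cosh t - Real.sinh t * Real.sinh t) / Real.cosh t ^ 2) t := by
    have h := (Real.hasDerivAt_sinh t).div (Real.hasDerivAt_cosh t) hc.ne'
    exact h.congr_of_eventuallyEq (.of_forall fun s => Real.tanh_eq_sinh_div_cosh s)
  refine (htanh.const_mul r).arctan.congr_deriv ?_
  have hid : Real.cosh t * Real.cosh t - Real.sinh t * Real.sinh t = 1 := by
    linarith [Real.cosh_sq t]
  have hpos : 0 < Real.cosh t ^ 2 + r ^ 2 * Real.sinh t ^ 2 := by positivity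
  rw [hid, Real.tanh_eq_sinh_div_cosh]
  field_simp

theorem continuous_arctan_mul_tanh (r : ℝ) : Continuous fun s => arctan (r * Real.tanh s) :=
  continuous_iff_continuousAt.2 fun t => (hasDerivAt_arctan_mul_tanh r t).continuousAt

theorem concaveOn_arctan_mul_tanh {r : ℝ} (hr : 0 ≤ r) :
    ConcaveOn ℝ (Set.Ici 0) fun s => arctan (r * Real.tanh s) := by
  refine AntitoneOn.concaveOn_of_deriv (convex_Ici 0) (continuous_arctan_mul_tanh r).continuousOn
    (fun t _ => (hasDerivAt_arctan_mul_tanh r t).differentiableAt.differentiableWithinAt) ?_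
  intro s hs t ht hst
  rw [interior_Ici, Set.mem_Ioi] at hs ht
  rw [(hasDerivAt_arctan_mul_tanh r s).deriv, (hasDerivAt_arctan_mul_tanh r t).deriv]
  have hsinh : Real.sinh s ≤ Real.sinh t := Real.sinh_le_sinh.2 hst
  have hsinh_nonneg : 0 ≤ Real.sinh s := Real.sinh_nonneg_iff.2 hs.le
  have hcosh : Real.cosh s ≤ Real.cosh t :=
    Real.cosh_le_cosh.2 (by rwa [abs_of_pos hs, abs_of_pos ht])
  have hcosh_pos : 0 < Real.cosh s := Real.cosh_pos s
  gcongr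

/-- Below the pole of `tan` following `m * π`, the equation `tan x = y` is solved by `arctan`. -/
theorem tan_eq_iff_sub_nat_mul_pi_eq_arctan {m : ℕ} {x y : ℝ} (h₁ : m * π < x)
    (h₂ : x < m * π + π / 2) : tan x = y ↔ x - m * π = arctan y := by
  rw [← Real.tan_sub_nat_mul_pi x m]
  constructor
  · rintro rfl
    exact (arctan_tan (by linarith [pi_pos]) (by linarith)).symm
  · intro h
    rw [h, tan_arctan]

theorem existsUnique_tan_eq_mul_tanh_s9 {α β r : ℝ} (hα : 0 < α) (hβ : 0 < β) (hr : 0 < r)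
    {m : ℕ} (hm : 1 ≤ m) :
    ∃! τ : ℝ, τ ∈ Set.Ioo (m * π / α) ((2 * m + 1) * π / (2 * α)) ∧
      tan (α * τ) = r * Real.tanh (β * τ) := by
  have hm' : (0 : ℝ) < m := by exact_mod_cast hm
  have hmπ : 0 < m * π := mul_pos hm' pi_pos
  have bounds {τ : ℝ} (hτ : τ ∈ Set.Ioo (m * π / α) ((2 * m + 1) * π / (2 * α))) :
      m * π < α * τ ∧ α * τ < m * π + π / 2 := by
    obtain ⟨h₁, h₂⟩ := hτ
    rw [div_lt_iff₀ hα] at h₁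
    rw [lt_div_iff₀ (by positivity)] at h₂
    constructor <;> linarith
  have equation {τ : ℝ} (hτ : τ ∈ Set.Ioo (m * π / α) ((2 * m + 1) * π / (2 * α))) :=
    tan_eq_iff_sub_nat_mul_pi_eq_arctan (y := r * Real.tanh (β * τ)) (bounds hτ).1 (bounds hτ).2
  have no_two {s t : ℝ} (hs : 0 < s) (hst : s < t)
      (es : α * s - m * π = arctan (r * Real.tanh (β * s)))
      (et : α * t - m * π = arctan (r * Real.tanh (β * t))) : False := by
    have ht : 0 < t := hs.trans hst
    have hlt : s / t < 1 := (div_lt_one ht).2 hst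
    have h := (concaveOn_arctan_mul_tanh hr.le).2 (Set.mem_Ici.2 le_rfl)
      (Set.mem_Ici.2 (mul_pos hβ ht).le) (sub_nonneg.2 hlt.le) (div_pos hs ht).le
      (sub_add_cancel 1 (s / t))
    have hmul : s / t * (β * t) = β * s := by field_simp
    simp only [smul_eq_mul, Real.tanh_zero, mul_zero, arctan_zero, zero_add, hmul] at h
    rw [← es, ← et] at h
    have hcancel : s / t * (α * t - m * π) = α * s - s / t * (m * π) := by field_simp
    rw [hcancel] at h
    nlinarith
  have hab : m * π / α < (2 * m + 1) * π / (2 * α) := by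
    rw [div_lt_div_iff₀ hα (by positivity)]
    nlinarith [mul_pos pi_pos hα]
  have hcont : Continuous fun τ => α * τ - m * π - arctan (r * Real.tanh (β * τ)) :=
    (by fun_prop : Continuous fun τ => α * τ - m * π).sub
      ((continuous_arctan_mul_tanh r).comp (continuous_const_mul β))
  obtain ⟨τ, hτ, hzero⟩ := intermediate_value_Ioo hab.le hcont.continuousOn
    (show (0 : ℝ) ∈ Set.Ioo _ _ by
      constructor
      · have hleft : α * (m * π / α) = m * π := by field_simp
        have htanh : 0 < Real.tanh (β * (m * π / α)) := by
          rw [Real.tanh_eq_sinh_div_cosh]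
          exact div_pos (Real.sinh_pos_iff.2 (by positivity)) (Real.cosh_pos _)
        have harctan := arctan_pos.2 (mul_pos hr htanh)
        simp only [hleft]
        linarith
      · have hright : α * ((2 * m + 1) * π / (2 * α)) = m * π + π / 2 := by field_simp
        have harctan := arctan_lt_pi_div_two (r * Real.tanh (β * ((2 * m + 1) * π / (2 * α))))
        simp only [hright]
        linarith)
  refine ⟨τ, ⟨hτ, (equation hτ).2 (sub_eq_zero.1 hzero)⟩, ?_⟩
  rintro t ⟨ht, htan⟩
  have pos {x : ℝ} (hx : x ∈ Set.Ioo (m * π / α) ((2 * m + 1) * π / (2 * α))) : 0 < x :=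
    (div_pos hmπ hα).trans hx.1
  rcases lt_trichotomy t τ with h | h | h
  · exact (no_two (pos ht) h ((equation ht).1 htan) (sub_eq_zero.1 hzero)).elim
  · exact h
  · exact (no_two (pos hτ) h (sub_eq_zero.1 hzero) ((equation ht).1 htan)).elim

/-- Lemma 4.4 (ii): for every `m ≥ 1` there is exactly one `τ` in the
interval `(mπ/(k₋|a₋|), (2m+1)π/(2k₋|a₋|))` with
`σ₊ k₊ tan(τ k₋ a₋) = σ₋ k₋ tanh(τ k₊ a₊)`. -/
theorem stmt_9 (am ap σm σp cm cp km kp : ℝ)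
    (ham : am < 0) (hap : 0 < ap) (hσm : σm < 0) (hσp : 0 < σp)
    (hcm : 0 < cm) (hcp : 0 < cp)
    (hkm : km = Real.sqrt (cm / (-σm))) (hkp : kp = Real.sqrt (cp / σp)) :
    ∀ m : ℕ, 1 ≤ m →
      ∃! τ : ℝ,
        τ ∈ Set.Ioo ((m * π) / (km * |am|)) (((2 * m + 1) * π) / (2 * km * |am|)) ∧
        σp * kp * Real.tan (τ * km * am) = σm * km * Real.tanh (τ * kp * ap) := by
  intro m hm
  have hkm_pos : 0 < km := hkm ▸ Real.sqrt_pos.2 (div_pos hcm (neg_pos.2 hσm))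
  have hkp_pos : 0 < kp := hkp ▸ Real.sqrt_pos.2 (div_pos hcp hσp)
  have hA : 0 < σp * kp := mul_pos hσp hkp_pos
  have key := existsUnique_tan_eq_mul_tanh_s9 (mul_pos hkm_pos (abs_pos.2 ham.ne))
    (mul_pos hkp_pos hap) (div_pos (mul_pos (neg_pos.2 hσm) hkm_pos) hA) hm
  refine (existsUnique_congr fun τ => ?_).1 key
  rw [← mul_assoc 2 km |am|]
  refine and_congr_right fun _ => ?_
  have htan : τ * km * am = -(km * |am| * τ) := by
    rw [abs_of_neg ham]
    ring
  rw [htan, Real.tan_neg, mul_comm (kp * ap) τ, ← mul_assoc τ kp ap, div_mul_eq_mul_div,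
    eq_div_iff hA.ne']
  constructor <;> intro h <;> linarith
end

section
/- Let a₋ < 0 < a₊, σ₋ < 0 < σ₊, and c₋, c₊ > 0 be real constants, and set k₋ := √(c₋/(−σ₋)), k₊ := √(c₊/σ₊). Then the equation σ₋ k₋ tan(τ k₊ a₊) = σ₊ k₊ tanh(τ k₋ a₋) has a solution τ with τ k₊ a₊ ∈ (0, π/2) if and only if (σ₊ a₋)/(a₊ σ₋) > 1, and in that case the solution in this range is unique. -/
open Real

theorem Real.hasDerivAt_tanh (x : ℝ) : HasDerivAt tanh (1 / cosh x ^ 2) x := by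
  have h := (hasDerivAt_sinh x).div (hasDerivAt_cosh x) (cosh_pos x).ne'
  have hfun : tanh = sinh / cosh := funext tanh_eq_sinh_div_cosh
  rw [hfun]
  refine h.congr_deriv ?_
  rw [← sq, ← sq, cosh_sq_sub_sinh_sq]

theorem hasDerivAt_arctan_mul_tanh_s10 (q m x : ℝ) :
    HasDerivAt (fun x => arctan (q * tanh (m * x)))
      (q * m / (cosh (m * x) ^ 2 + q ^ 2 * sinh (m * x) ^ 2)) x := by
  have hlin : HasDerivAt (fun x => m * x) m x := by
    simpa using (hasDerivAt_id x).const_mul m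
  have h := (((hasDerivAt_tanh (m * x)).comp x hlin).const_mul q).arctan
  have hc := cosh_pos (m * x)
  refine h.congr_deriv ?_
  simp only [Function.comp_apply, tanh_eq_sinh_div_cosh]
  field_simp

theorem strictAntiOn_deriv_arctan_mul_tanh {q m : ℝ} (hq : 0 < q) (hm : 0 < m) :
    StrictAntiOn (fun x => q * m / (cosh (m * x) ^ 2 + q ^ 2 * sinh (m * x) ^ 2))
      (Set.Ici 0) := by
  intro x hx y _ hxy
  have hx' : 0 ≤ m * x := mul_nonneg hm.le hx
  have hlt : m * x < m * y := mul_lt_mul_of_pos_left hxy hm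
  have hc : cosh (m * x) < cosh (m * y) :=
    cosh_strictMonoOn hx' (hx'.trans hlt.le) hlt
  have hs : sinh (m * x) < sinh (m * y) := sinh_lt_sinh.2 hlt
  have hs0 : 0 ≤ sinh (m * x) := sinh_nonneg_iff.2 hx'
  have hc0 := cosh_pos (m * x)
  dsimp only
  gcongr

theorem one_lt_of_arctan_mul_tanh_eq_self {q m x : ℝ} (hq : 0 < q) (hm : 0 < m) (hx : 0 < x)
    (h : arctan (q * tanh (m * x)) = x) : 1 < q * m := by
  have hd (y : ℝ) := (hasDerivAt_arctan_mul_tanh_s10 q m y).sub (hasDerivAt_id y)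
  obtain ⟨c, hc, hc0⟩ := exists_hasDerivAt_eq_zero hx
    (fun y _ => (hd y).continuousAt.continuousWithinAt) (by simp [h]) (fun y _ => hd y)
  have := strictAntiOn_deriv_arctan_mul_tanh hq hm Set.self_mem_Ici hc.1.le hc.1
  simp only [mul_zero, cosh_zero, sinh_zero] at this
  norm_num at this
  linarith

theorem eq_of_arctan_mul_tanh_eq_self {q m x y : ℝ} (hq : 0 < q) (hm : 0 < m)
    (hx : 0 < x) (hy : 0 < y) (hfx : arctan (q * tanh (m * x)) = x)
    (hfy : arctan (q * tanh (m * y)) = y) : x = y := by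
  wlog hxy : x ≤ y generalizing x y
  · exact (this hy hx hfy hfx (le_of_not_ge hxy)).symm
  refine hxy.eq_of_not_lt fun hlt => ?_
  have hd (z : ℝ) := (hasDerivAt_arctan_mul_tanh_s10 q m z).sub (hasDerivAt_id z)
  obtain ⟨c, hc, hc0⟩ := exists_hasDerivAt_eq_zero hx
    (fun y _ => (hd y).continuousAt.continuousWithinAt) (by simp [hfx]) (fun y _ => hd y)
  obtain ⟨d, hd, hd0⟩ := exists_hasDerivAt_eq_zero hlt
    (fun y _ => (hd y).continuousAt.continuousWithinAt) (by simp [hfx, hfy]) (fun y _ => hd y)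
  have := strictAntiOn_deriv_arctan_mul_tanh hq hm hc.1.le (hx.trans hd.1).le
    (hc.2.trans hd.1)
  dsimp only at this
  linarith

theorem exists_arctan_mul_tanh_eq_self {q m : ℝ} (h : 1 < q * m) :
    ∃ x, 0 < x ∧ arctan (q * tanh (m * x)) = x := by
  have hd (y : ℝ) := (hasDerivAt_arctan_mul_tanh_s10 q m y).sub (hasDerivAt_id y)
  set f := (fun x => arctan (q * tanh (m * x))) - id with hf
  have h0 : HasDerivAt f (q * m - 1) 0 := by simpa using hd 0
  obtain ⟨x, hx, hx0, hxπ⟩ := ((((hasDerivAt_iff_tendsto_slope_left_right.1 h0).2.eventually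
    (lt_mem_nhds (sub_pos.2 h))).and (Ioo_mem_nhdsGT (half_pos pi_pos)))).exists
  have hfx : 0 < f x := by
    rw [slope_def_field, sub_zero, div_pos_iff_of_pos_right hx0] at hx
    simpa [hf] using hx
  have hfπ : f (π / 2) < 0 := by
    simpa [hf] using arctan_lt_pi_div_two (q * tanh (m * (π / 2)))
  obtain ⟨y, hy, hy0⟩ := intermediate_value_Icc' hxπ.le
    (fun y _ => (hd y).continuousAt.continuousWithinAt) ⟨hfπ.le, hfx.le⟩
  exact ⟨y, hx0.trans_le hy.1, by simpa [hf, sub_eq_zero] using hy0⟩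

theorem mem_Ioo_and_tan_eq_iff {x r : ℝ} :
    x ∈ Set.Ioo 0 (π / 2) ∧ tan x = r ↔ 0 < x ∧ arctan r = x := by
  constructor
  · rintro ⟨⟨h0, hπ⟩, rfl⟩
    exact ⟨h0, arctan_tan (by linarith [pi_pos]) hπ⟩
  · rintro ⟨h0, rfl⟩
    exact ⟨⟨h0, arctan_lt_pi_div_two r⟩, tan_arctan r⟩

/-- Lemma 4.4 (iii), positive principal eigenvalue: the equation
`σ₋ k₋ tan(τ k₊ a₊) = σ₊ k₊ tanh(τ k₋ a₋)` has a solution with `τ k₊ a₊ ∈ (0, π/2)` if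
and only if `(σ₊ a₋)/(a₊ σ₋) > 1`, and in that case the solution in this range is unique. -/
theorem stmt_10 (am ap σm σp cm cp km kp : ℝ)
    (ham : am < 0) (hap : 0 < ap) (hσm : σm < 0) (hσp : 0 < σp)
    (hcm : 0 < cm) (hcp : 0 < cp)
    (hkm : km = Real.sqrt (cm / (-σm))) (hkp : kp = Real.sqrt (cp / σp)) :
    ((∃ τ : ℝ, τ * kp * ap ∈ Set.Ioo 0 (π / 2) ∧
        σm * km * Real.tan (τ * kp * ap) = σp * kp * Real.tanh (τ * km * am)) ↔
      1 < (σp * am) / (ap * σm)) ∧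
    (1 < (σp * am) / (ap * σm) →
      ∃! τ : ℝ, τ * kp * ap ∈ Set.Ioo 0 (π / 2) ∧
        σm * km * Real.tan (τ * kp * ap) = σp * kp * Real.tanh (τ * km * am)) := by
  have hkm0 : 0 < km := hkm ▸ Real.sqrt_pos.2 (div_pos hcm (neg_pos.2 hσm))
  have hkp0 : 0 < kp := hkp ▸ Real.sqrt_pos.2 (div_pos hcp hσp)
  clear hkm hkp
  obtain ⟨q, hq⟩ : ∃ q, q = σp * kp / (-σm * km) := ⟨_, rfl⟩
  obtain ⟨m, hm⟩ : ∃ m, m = km * -am / (kp * ap) := ⟨_, rfl⟩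
  have hq0 : 0 < q := hq ▸ div_pos (mul_pos hσp hkp0) (mul_pos (neg_pos.2 hσm) hkm0)
  have hm0 : 0 < m := hm ▸ div_pos (mul_pos hkm0 (neg_pos.2 ham)) (mul_pos hkp0 hap)
  have hqm : (σp * am) / (ap * σm) = q * m := by
    rw [hq, hm]
    field_simp
  have hiff (τ : ℝ) : (τ * kp * ap ∈ Set.Ioo 0 (π / 2) ∧
      σm * km * Real.tan (τ * kp * ap) = σp * kp * Real.tanh (τ * km * am)) ↔
      0 < τ * kp * ap ∧ arctan (q * tanh (m * (τ * kp * ap))) = τ * kp * ap := by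
    rw [← mem_Ioo_and_tan_eq_iff]
    refine and_congr_right fun _ => ?_
    have harg : m * (τ * kp * ap) = -(τ * km * am) := by
      rw [hm]
      field_simp
    rw [harg, tanh_neg, hq, div_mul_eq_mul_div,
      eq_div_iff (mul_pos (neg_pos.2 hσm) hkm0).ne']
    constructor <;> intro h <;> linarith
  simp only [hiff, hqm]
  have hex (h : 1 < q * m) : ∃ τ : ℝ, 0 < τ * kp * ap ∧
      arctan (q * tanh (m * (τ * kp * ap))) = τ * kp * ap := by
    obtain ⟨x, hx⟩ := exists_arctan_mul_tanh_eq_self h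
    refine ⟨x / (kp * ap), ?_⟩
    have hx' : x / (kp * ap) * kp * ap = x := by field_simp
    rwa [hx']
  refine ⟨⟨fun ⟨τ, h0, h⟩ => one_lt_of_arctan_mul_tanh_eq_self hq0 hm0 h0 h, hex⟩,
    fun h => existsUnique_of_exists_of_unique (hex h) ?_⟩
  rintro τ₁ τ₂ ⟨h1, h1'⟩ ⟨h2, h2'⟩
  have := eq_of_arctan_mul_tanh_eq_self hq0 hm0 h1 h2 h1' h2'
  exact mul_right_cancel₀ hkp0.ne' (mul_right_cancel₀ hap.ne' this)
end

section
/- Let a₋ < 0 < a₊, σ₋ < 0 < σ₊, and c₋, c₊ > 0 be real constants, and set k₋ := √(c₋/(−σ₋)), k₊ := √(c₊/σ₊). Then the equation σ₊ k₊ tan(τ k₋ a₋) = σ₋ k₋ tanh(τ k₊ a₊) has a solution τ with τ k₋ |a₋| ∈ (0, π/2) if and only if (σ₊ a₋)/(a₊ σ₋) < 1, and in that case the solution in this range is unique. -/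
open Real

theorem StrictConvexOn.eq_of_eq_zero {f : ℝ → ℝ} {T s t : ℝ}
    (hf : StrictConvexOn ℝ (Set.Ico 0 T) f) (h0 : f 0 = 0)
    (hs : s ∈ Set.Ioo 0 T) (ht : t ∈ Set.Ioo 0 T) (hfs : f s = 0) (hft : f t = 0) : s = t := by
  wlog hst : s ≤ t generalizing s t
  · exact (this ht hs hft hfs (le_of_not_ge hst)).symm
  by_contra hne
  have hlt : s < t := lt_of_le_of_ne hst hne
  have h := hf.slope_strict_mono_adjacent ⟨le_rfl, hs.1.trans hs.2⟩ ⟨ht.1.le, ht.2⟩ hs.1 hlt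
  simp [h0, hfs, hft] at h

theorem StrictConvexOn.exists_eq_zero_iff {f : ℝ → ℝ} {T d s : ℝ}
    (hf : StrictConvexOn ℝ (Set.Ico 0 T) f) (hc : ContinuousOn f (Set.Ico 0 T)) (h0 : f 0 = 0)
    (hd : HasDerivAt f d 0) (hs : s ∈ Set.Ioo 0 T) (hfs : 0 < f s) :
    (∃ t ∈ Set.Ioo 0 T, f t = 0) ↔ d < 0 := by
  constructor
  · rintro ⟨t, ht, hft⟩
    have h := hf.lt_slope_of_hasDerivAt ⟨le_rfl, ht.1.trans ht.2⟩ ⟨ht.1.le, ht.2⟩ ht.1 hd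
    simpa [slope_def_field, h0, hft] using h
  · intro hneg
    have hlim := (hasDerivWithinAt_iff_tendsto_slope' Set.self_notMem_Ioi).mp
      (hd.hasDerivWithinAt (s := Set.Ioi 0))
    obtain ⟨r, hr, hr'⟩ :=
      ((hlim.eventually (gt_mem_nhds hneg)).and (Ioo_mem_nhdsGT hs.1)).exists
    have hfr : f r < 0 := by
      rw [slope_def_field, h0, sub_zero, sub_zero, div_lt_iff₀ hr'.1, zero_mul] at hr
      exact hr
    obtain ⟨t, ht, hft⟩ := intermediate_value_Icc hr'.2.le
      (hc.mono fun x hx ↦ ⟨hr'.1.le.trans hx.1, hx.2.trans_lt hs.2⟩) ⟨hfr.le, hfs.le⟩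
    exact ⟨t, ⟨hr'.1.trans_le ht.1, ht.2.trans_lt hs.2⟩, hft⟩

section TanTanh

variable {p q a b : ℝ}

theorem hasDerivAt_tan_sub_tanh (p q a b : ℝ) {t : ℝ} (ht : cos (t * a) ≠ 0) :
    HasDerivAt (fun t ↦ p * tan (t * a) - q * tanh (t * b))
      (p * (1 / cos (t * a) ^ 2 * a) - q * (1 / cosh (t * b) ^ 2 * b)) t := by
  have htan := (Real.hasDerivAt_tan ht).comp t (hasDerivAt_mul_const a)
  have htanh := (Real.hasDerivAt_tanh (t * b)).comp t (hasDerivAt_mul_const b)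
  exact (htan.const_mul p).sub (htanh.const_mul q)

theorem cos_mul_pos_of_mem_Ico (ha : 0 < a) {t : ℝ} (ht : t ∈ Set.Ico 0 (π / 2 / a)) :
    0 < cos (t * a) :=
  cos_pos_of_mem_Ioo ⟨by linarith [pi_pos, mul_nonneg ht.1 ha.le], (lt_div_iff₀ ha).mp ht.2⟩

theorem continuousOn_tan_sub_tanh (ha : 0 < a) :
    ContinuousOn (fun t ↦ p * tan (t * a) - q * tanh (t * b)) (Set.Ico 0 (π / 2 / a)) :=
  fun _ ht ↦ (hasDerivAt_tan_sub_tanh p q a b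
    (cos_mul_pos_of_mem_Ico ha ht).ne').continuousAt.continuousWithinAt

theorem strictConvexOn_tan_sub_tanh (hp : 0 < p) (hq : 0 < q) (ha : 0 < a) (hb : 0 < b) :
    StrictConvexOn ℝ (Set.Ico 0 (π / 2 / a)) fun t ↦ p * tan (t * a) - q * tanh (t * b) := by
  refine StrictMonoOn.strictConvexOn_of_deriv (convex_Ico _ _) (continuousOn_tan_sub_tanh ha) ?_
  rw [interior_Ico]
  intro s hs t ht hst
  have hcs := cos_mul_pos_of_mem_Ico ha ⟨hs.1.le, hs.2⟩
  have hct := cos_mul_pos_of_mem_Ico ha ⟨ht.1.le, ht.2⟩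
  rw [(hasDerivAt_tan_sub_tanh p q a b hcs.ne').deriv,
    (hasDerivAt_tan_sub_tanh p q a b hct.ne').deriv]
  have hcos : cos (t * a) < cos (s * a) :=
    cos_lt_cos_of_nonneg_of_le_pi_div_two (mul_pos hs.1 ha).le
      ((lt_div_iff₀ ha).mp ht.2).le (mul_lt_mul_of_pos_right hst ha)
  have hcosh : cosh (s * b) < cosh (t * b) :=
    cosh_strictMonoOn (mul_pos hs.1 hb).le (mul_pos ht.1 hb).le (mul_lt_mul_of_pos_right hst hb)
  have := cosh_pos (s * b)
  gcongr

theorem exists_tan_sub_tanh_pos (hp : 0 < p) (hq : 0 < q) (ha : 0 < a) :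
    ∃ s ∈ Set.Ioo 0 (π / 2 / a), 0 < p * tan (s * a) - q * tanh (s * b) := by
  refine ⟨arctan (q / p) / a, ⟨div_pos (arctan_pos.mpr (div_pos hq hp)) ha,
    div_lt_div_of_pos_right (arctan_lt_pi_div_two _) ha⟩, ?_⟩
  rw [div_mul_cancel₀ _ ha.ne', tan_arctan, mul_div_cancel₀ _ hp.ne', sub_pos]
  exact mul_lt_of_lt_one_right hq (tanh_lt_one _)

theorem exists_tan_sub_tanh_eq_zero_iff (hp : 0 < p) (hq : 0 < q) (ha : 0 < a) (hb : 0 < b) :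
    (∃ t ∈ Set.Ioo 0 (π / 2 / a), p * tan (t * a) - q * tanh (t * b) = 0) ↔ p * a < q * b := by
  obtain ⟨s, hs, hfs⟩ := exists_tan_sub_tanh_pos (b := b) hp hq ha
  rw [(strictConvexOn_tan_sub_tanh hp hq ha hb).exists_eq_zero_iff (continuousOn_tan_sub_tanh ha)
    (by simp) (hasDerivAt_tan_sub_tanh p q a b (by simp)) hs hfs]
  simp

end TanTanh

/-- Lemma 4.4 (iii), negative principal eigenvalue: the equation
`σ₊ k₊ tan(τ k₋ a₋) = σ₋ k₋ tanh(τ k₊ a₊)` has a solution with `τ k₋ |a₋| ∈ (0, π/2)` if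
and only if `(σ₊ a₋)/(a₊ σ₋) < 1`, and in that case the solution in this range is unique. -/
theorem stmt_11 (am ap σm σp cm cp km kp : ℝ)
    (ham : am < 0) (hap : 0 < ap) (hσm : σm < 0) (hσp : 0 < σp)
    (hcm : 0 < cm) (hcp : 0 < cp)
    (hkm : km = Real.sqrt (cm / (-σm))) (hkp : kp = Real.sqrt (cp / σp)) :
    ((∃ τ : ℝ, τ * km * |am| ∈ Set.Ioo 0 (π / 2) ∧
        σp * kp * Real.tan (τ * km * am) = σm * km * Real.tanh (τ * kp * ap)) ↔
      (σp * am) / (ap * σm) < 1) ∧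
    ((σp * am) / (ap * σm) < 1 →
      ∃! τ : ℝ, τ * km * |am| ∈ Set.Ioo 0 (π / 2) ∧
        σp * kp * Real.tan (τ * km * am) = σm * km * Real.tanh (τ * kp * ap)) := by
  have hkm0 : 0 < km := hkm ▸ Real.sqrt_pos.mpr (div_pos hcm (neg_pos.mpr hσm))
  have hkp0 : 0 < kp := hkp ▸ Real.sqrt_pos.mpr (div_pos hcp hσp)
  have hp : 0 < σp * kp := mul_pos hσp hkp0
  have hq : 0 < -σm * km := mul_pos (neg_pos.mpr hσm) hkm0
  have ha : 0 < km * -am := mul_pos hkm0 (neg_pos.mpr ham)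
  have hb : 0 < kp * ap := mul_pos hkp0 hap
  have hiff (τ : ℝ) : (τ * km * |am| ∈ Set.Ioo 0 (π / 2) ∧
      σp * kp * Real.tan (τ * km * am) = σm * km * Real.tanh (τ * kp * ap)) ↔
      τ ∈ Set.Ioo 0 (π / 2 / (km * -am)) ∧
        σp * kp * tan (τ * (km * -am)) - -σm * km * tanh (τ * (kp * ap)) = 0 := by
    rw [abs_of_neg ham, mul_assoc, Set.mem_Ioo, Set.mem_Ioo, mul_pos_iff_of_pos_right ha,
      lt_div_iff₀ ha, show τ * (km * -am) = -(τ * km * am) by ring, tan_neg, mul_assoc τ kp ap]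
    refine and_congr_right fun _ ↦ ⟨fun h ↦ ?_, fun h ↦ ?_⟩ <;> linarith
  have hratio : σp * kp * (km * -am) < -σm * km * (kp * ap) ↔ (σp * am) / (ap * σm) < 1 := by
    rw [← neg_div_neg_eq, div_lt_one (by nlinarith),
      show σp * kp * (km * -am) = km * kp * -(σp * am) by ring,
      show -σm * km * (kp * ap) = km * kp * -(ap * σm) by ring,
      mul_lt_mul_iff_right₀ (mul_pos hkm0 hkp0)]
  have hex := (exists_tan_sub_tanh_eq_zero_iff hp hq ha hb).trans hratio
  simp only [hiff]
  refine ⟨hex, fun h ↦ ?_⟩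
  obtain ⟨τ, hτ, hzero⟩ := hex.mpr h
  exact ⟨τ, ⟨hτ, hzero⟩, fun t ht ↦ (strictConvexOn_tan_sub_tanh hp hq ha hb).eq_of_eq_zero
    (by simp) ht.1 hτ ht.2 hzero⟩
end

section
/- Let a₋ < 0 < a₊, σ₋ < 0 < σ₊, and c₋, c₊ > 0 be real constants, and set k₋ := √(c₋/(−σ₋)), k₊ := √(c₊/σ₊). For each integer j ≥ 1 let τ_j denote the unique solution in the interval ( jπ/(k₊ a₊), (2j+1)π/(2 k₊ a₊) ) of σ₋ k₋ tan(τ k₊ a₊) = σ₊ k₊ tanh(τ k₋ a₋). Then, as j → ∞, τ_j − jπ/(k₊ a₊) converges to (1/(k₊ a₊)) · arctan( σ₊ k₊ / ((−σ₋) k₋) ). -/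
open Real Filter Topology

theorem Real.tendsto_tanh_atBot : Tendsto Real.tanh atBot (𝓝 (-1)) := by
  have h : ∀ x : ℝ, Real.tanh x = (exp (2 * x) - 1) / (exp (2 * x) + 1) := by
    intro x
    have h2 : exp (2 * x) = exp x * exp x := by rw [two_mul, exp_add]
    have h3 : exp x * exp (-x) = 1 := by rw [← exp_add]; simp
    have hx := exp_pos x
    have hx' := exp_pos (-x)
    rw [tanh_eq, h2, div_eq_div_iff (by positivity) (by positivity)]
    linear_combination (-2 * exp x) * h3
  have he : Tendsto (fun x : ℝ => exp (2 * x)) atBot (𝓝 0) :=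
    tendsto_exp_atBot.comp (tendsto_id.const_mul_atBot two_pos)
  rw [funext h]
  simpa [Pi.div_def] using (he.sub_const 1).div (he.add_const 1) (by norm_num)

/-- eq. 5.7, positive eigenvalues: the solutions `τ_j` of
`σ₋ k₋ tan(τ k₊ a₊) = σ₊ k₊ tanh(τ k₋ a₋)` in `(jπ/(k₊a₊), (2j+1)π/(2k₊a₊))` satisfy
`τ_j - jπ/(k₊a₊) → (1/(k₊a₊)) arctan(σ₊k₊/((-σ₋)k₋))` as `j → ∞`. -/
theorem stmt_14 (am ap σm σp cm cp km kp : ℝ)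
    (ham : am < 0) (hap : 0 < ap) (hσm : σm < 0) (hσp : 0 < σp)
    (hcm : 0 < cm) (hcp : 0 < cp)
    (hkm : km = Real.sqrt (cm / (-σm))) (hkp : kp = Real.sqrt (cp / σp))
    (τ : ℕ → ℝ)
    (hτ : ∀ j : ℕ, 1 ≤ j →
      τ j ∈ Set.Ioo ((j * π) / (kp * ap)) (((2 * j + 1) * π) / (2 * kp * ap)) ∧
      σm * km * Real.tan (τ j * kp * ap) = σp * kp * Real.tanh (τ j * km * am)) :
    Tendsto (fun j : ℕ => τ j - (j * π) / (kp * ap)) atTop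
      (𝓝 ((1 / (kp * ap)) * Real.arctan (σp * kp / ((-σm) * km)))) := by
  have hkm0 : 0 < km := hkm ▸ Real.sqrt_pos.2 (div_pos hcm (neg_pos.2 hσm))
  have hkp0 : 0 < kp := hkp ▸ Real.sqrt_pos.2 (div_pos hcp hσp)
  have hL : 0 < kp * ap := mul_pos hkp0 hap
  have hτ_top : Tendsto τ atTop atTop := by
    have h : Tendsto (fun j : ℕ => (j * π) / (kp * ap)) atTop atTop :=
      (tendsto_natCast_atTop_atTop.atTop_mul_const pi_pos).atTop_div_const hL
    refine tendsto_atTop_mono' _ ?_ h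
    filter_upwards [eventually_ge_atTop 1] with j hj using (hτ j hj).1.1.le
  have h_tanh : Tendsto (fun j => Real.tanh (τ j * km * am)) atTop (𝓝 (-1)) :=
    Real.tendsto_tanh_atBot.comp
      ((hτ_top.atTop_mul_const hkm0).atTop_mul_const_of_neg ham)
  have h_lim := ((continuous_arctan.tendsto _).comp
    (h_tanh.const_mul (σp * kp / (σm * km)))).const_mul (1 / (kp * ap))
  have h_eq : σp * kp / (σm * km) * -1 = σp * kp / (-σm * km) := by
    rw [neg_mul, div_neg, mul_neg_one]
  rw [h_eq] at h_lim
  refine h_lim.congr' ?_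
  filter_upwards [eventually_ge_atTop 1] with j hj
  obtain ⟨⟨h_lo, h_hi⟩, h_tan⟩ := hτ j hj
  rw [div_lt_iff₀ hL] at h_lo
  rw [mul_assoc 2 kp ap, lt_div_iff₀ (by positivity)] at h_hi
  have h_ratio : σp * kp / (σm * km) * Real.tanh (τ j * km * am)
      = Real.tan (τ j * kp * ap - j * π) := by
    rw [tan_sub_nat_mul_pi, div_mul_eq_mul_div, ← h_tan,
      mul_div_cancel_left₀ _ (mul_neg_of_neg_of_pos hσm hkm0).ne]
  have h_arctan : Real.arctan (σp * kp / (σm * km) * Real.tanh (τ j * km * am))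
      = τ j * kp * ap - j * π := by
    rw [h_ratio]
    exact arctan_tan (by linarith [pi_pos]) (by linarith)
  simp only [Function.comp_apply, h_arctan]
  field_simp
end

section
/- Let a₋ < 0 < a₊, σ₋ < 0 < σ₊, and c₋, c₊ > 0 be real constants, and set k₋ := √(c₋/(−σ₋)), k₊ := √(c₊/σ₊). For each integer m ≥ 1 let τ′_m denote the unique solution in the interval ( mπ/(k₋ |a₋|), (2m+1)π/(2 k₋ |a₋|) ) of σ₊ k₊ tan(τ k₋ a₋) = σ₋ k₋ tanh(τ k₊ a₊). Then, as m → ∞, τ′_m − mπ/(k₋ |a₋|) converges to (1/(k₋ |a₋|)) · arctan( (−σ₋) k₋ / (σ₊ k₊) ). -/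
open Real Filter Topology

theorem Real.tendsto_tanh_atTop_one : Tendsto Real.tanh atTop (𝓝 1) := by
  have hexp : Tendsto (fun x : ℝ => Real.exp (-(2 * x))) atTop (𝓝 0) :=
    Real.tendsto_exp_neg_atTop_nhds_zero.comp (tendsto_id.const_mul_atTop two_pos)
  have hlim : Tendsto (fun x : ℝ => (1 - Real.exp (-(2 * x))) / (1 + Real.exp (-(2 * x)))) atTop
      (𝓝 ((1 - 0) / (1 + 0))) :=
    (hexp.const_sub 1).div (hexp.const_add 1) (by norm_num)
  rw [sub_zero, add_zero, div_one] at hlim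
  refine hlim.congr fun x => ?_
  have h : Real.exp (-(2 * x)) = Real.exp (-x) / Real.exp x := by
    rw [← Real.exp_sub]; ring_nf
  rw [Real.tanh_eq_sinh_div_cosh, Real.sinh_eq, Real.cosh_eq, h]
  field_simp

/-- eq. 5.7, negative eigenvalues: the solutions `τ′_m` of
`σ₊ k₊ tan(τ k₋ a₋) = σ₋ k₋ tanh(τ k₊ a₊)` in `(mπ/(k₋|a₋|), (2m+1)π/(2k₋|a₋|))` satisfy
`τ′_m - mπ/(k₋|a₋|) → (1/(k₋|a₋|)) arctan((-σ₋)k₋/(σ₊k₊))` as `m → ∞`. -/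
theorem stmt_15 (am ap σm σp cm cp km kp : ℝ)
    (ham : am < 0) (hap : 0 < ap) (hσm : σm < 0) (hσp : 0 < σp)
    (hcm : 0 < cm) (hcp : 0 < cp)
    (hkm : km = Real.sqrt (cm / (-σm))) (hkp : kp = Real.sqrt (cp / σp))
    (τ' : ℕ → ℝ)
    (hτ' : ∀ m : ℕ, 1 ≤ m →
      τ' m ∈ Set.Ioo ((m * π) / (km * |am|)) (((2 * m + 1) * π) / (2 * km * |am|)) ∧
      σp * kp * Real.tan (τ' m * km * am) = σm * km * Real.tanh (τ' m * kp * ap)) :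
    Tendsto (fun m : ℕ => τ' m - (m * π) / (km * |am|)) atTop
      (𝓝 ((1 / (km * |am|)) * Real.arctan ((-σm) * km / (σp * kp)))) := by
  have hkm0 : 0 < km := hkm ▸ Real.sqrt_pos.2 (div_pos hcm (neg_pos.2 hσm))
  have hkp0 : 0 < kp := hkp ▸ Real.sqrt_pos.2 (div_pos hcp hσp)
  have hb : 0 < km * |am| := mul_pos hkm0 (abs_pos.2 ham.ne)
  have hbam : km * |am| = -(km * am) := by rw [abs_of_neg ham]; ring
  set b := km * |am| with hb_def
  have hrepr : ∀ m : ℕ, 1 ≤ m → τ' m - (m * π) / b =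
      1 / b * Real.arctan ((-σm) * km / (σp * kp) * Real.tanh (τ' m * kp * ap)) := by
    intro m hm
    obtain ⟨⟨hl, hu⟩, heq⟩ := hτ' m hm
    rw [div_lt_iff₀ hb] at hl
    rw [mul_assoc 2 km, ← hb_def, lt_div_iff₀ (by positivity)] at hu
    have htan : Real.tan (τ' m * b - m * π) =
        (-σm) * km / (σp * kp) * Real.tanh (τ' m * kp * ap) := by
      rw [Real.tan_sub_nat_mul_pi, hbam, mul_neg, Real.tan_neg, ← mul_assoc, div_mul_eq_mul_div,
        eq_div_iff (by positivity)]
      linarith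
    rw [← htan, Real.arctan_tan (by linarith [Real.pi_pos]) (by linarith)]
    field_simp
  have hτ : Tendsto τ' atTop atTop := by
    have hlin : Tendsto (fun m : ℕ => (m * π) / b) atTop atTop :=
      (tendsto_natCast_atTop_atTop.atTop_mul_const Real.pi_pos).atTop_div_const hb
    refine tendsto_atTop_mono' _ ?_ hlin
    filter_upwards [eventually_ge_atTop 1] with m hm using (hτ' m hm).1.1.le
  have htanh : Tendsto (fun m => Real.tanh (τ' m * kp * ap)) atTop (𝓝 1) :=
    Real.tendsto_tanh_atTop_one.comp ((hτ.atTop_mul_const hkp0).atTop_mul_const hap)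
  have hlim := ((Real.continuous_arctan.tendsto _).comp
    (htanh.const_mul ((-σm) * km / (σp * kp)))).const_mul (1 / b)
  rw [mul_one] at hlim
  refine hlim.congr' ?_
  filter_upwards [eventually_ge_atTop 1] with m hm using (hrepr m hm).symm
end

section
/- Let a₋ < 0 < a₊, σ₋ < 0 < σ₊, and c₋, c₊ > 0 be real constants, and set k₋ := √(c₋/(−σ₋)), k₊ := √(c₊/σ₊). For each integer j ≥ 1 let τ_j denote the unique solution in the interval ( jπ/(k₊ a₊), (2j+1)π/(2 k₊ a₊) ) of σ₋ k₋ tan(τ k₊ a₊) = σ₊ k₊ tanh(τ k₋ a₋). Then the quantity a₊ c₊ / (2 sin²(τ_j k₊ a₊)) + a₋ c₋ / (2 sinh²(τ_j k₋ a₋)) converges to a₊ ( σ₊ c₊ + (−σ₋) c₋ ) / (2 σ₊) as j → ∞. -/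
open Real Filter Topology

theorem Real.inv_sin_sq_eq_of_tan_ne_zero {x : ℝ} (hx : tan x ≠ 0) :
    (sin x ^ 2)⁻¹ = 1 + (tan x ^ 2)⁻¹ := by
  rw [tan_eq_sin_div_cos] at hx ⊢
  obtain ⟨hs, hc⟩ := div_ne_zero_iff.mp hx
  field_simp
  linarith [sin_sq_add_cos_sq x]

theorem Real.inv_tanh_sq_eq_of_ne_zero {x : ℝ} (hx : x ≠ 0) :
    (tanh x ^ 2)⁻¹ = 1 + (sinh x ^ 2)⁻¹ := by
  have hs : sinh x ≠ 0 := sinh_ne_zero.mpr hx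
  have hc := (cosh_pos x).ne'
  rw [tanh_eq_sinh_div_cosh]
  field_simp
  linarith [cosh_sq x]

theorem Real.tendsto_inv_sinh_sq_atBot :
    Tendsto (fun x : ℝ => (sinh x ^ 2)⁻¹) atBot (𝓝 0) := by
  have h : Tendsto sinh atBot atBot :=
    tendsto_atBot_mono' _ ((eventually_le_atBot 0).mono fun x hx => sinh_le_self_iff.mpr hx)
      tendsto_id
  refine tendsto_inv_atTop_zero.comp ?_
  simpa only [pow_two] using h.atBot_mul_atBot₀ h



/-- normalization asymptotics in the proof of Lemma 5.4: the solutions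
`τ_j` of `σ₋ k₋ tan(τ k₊ a₊) = σ₊ k₊ tanh(τ k₋ a₋)` in `(jπ/(k₊a₊), (2j+1)π/(2k₊a₊))`
satisfy `a₊c₊/(2sin²(τ_jk₊a₊)) + a₋c₋/(2sinh²(τ_jk₋a₋)) → a₊(σ₊c₊ + (-σ₋)c₋)/(2σ₊)`
as `j → ∞`. -/
theorem stmt_17 (am ap σm σp cm cp km kp : ℝ)
    (ham : am < 0) (hap : 0 < ap) (hσm : σm < 0) (hσp : 0 < σp)
    (hcm : 0 < cm) (hcp : 0 < cp)
    (hkm : km = Real.sqrt (cm / (-σm))) (hkp : kp = Real.sqrt (cp / σp))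
    (τ : ℕ → ℝ)
    (hτ : ∀ j : ℕ, 1 ≤ j →
      τ j ∈ Set.Ioo ((j * π) / (kp * ap)) (((2 * j + 1) * π) / (2 * kp * ap)) ∧
      σm * km * Real.tan (τ j * kp * ap) = σp * kp * Real.tanh (τ j * km * am)) :
    Tendsto (fun j : ℕ =>
        ap * cp / (2 * Real.sin (τ j * kp * ap) ^ 2) +
        am * cm / (2 * Real.sinh (τ j * km * am) ^ 2)) atTop
      (𝓝 (ap * (σp * cp + (-σm) * cm) / (2 * σp))) := by
  have hkm0 : 0 < km := hkm ▸ Real.sqrt_pos.mpr (div_pos hcm (neg_pos.mpr hσm))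
  have hkp0 : 0 < kp := hkp ▸ Real.sqrt_pos.mpr (div_pos hcp hσp)
  have hkm2 : km ^ 2 = cm / (-σm) := by
    rw [hkm, Real.sq_sqrt (div_pos hcm (neg_pos.mpr hσm)).le]
  have hkp2 : kp ^ 2 = cp / σp := by rw [hkp, Real.sq_sqrt (div_pos hcp hσp).le]
  have hτtop : Tendsto τ atTop atTop := by
    have h : Tendsto (fun j : ℕ => (j * π) / (kp * ap)) atTop atTop :=
      (tendsto_natCast_atTop_atTop.atTop_mul_const pi_pos).atTop_div_const (mul_pos hkp0 hap)
    exact tendsto_atTop_mono' _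
      ((eventually_ge_atTop 1).mono fun j hj => (hτ j hj).1.1.le) h
  have hxbot : Tendsto (fun j => τ j * km * am) atTop atBot :=
    (hτtop.atTop_mul_const hkm0).atTop_mul_const_of_neg ham
  have hS : Tendsto (fun j => (Real.sinh (τ j * km * am) ^ 2)⁻¹) atTop (𝓝 0) :=
    Real.tendsto_inv_sinh_sq_atBot.comp hxbot
  have hlim : Tendsto (fun j =>
      ap * cp / 2 * (1 + (-σm) * cm / (σp * cp) * (1 + (Real.sinh (τ j * km * am) ^ 2)⁻¹)) +
        am * cm / 2 * (Real.sinh (τ j * km * am) ^ 2)⁻¹) atTop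
      (𝓝 (ap * cp / 2 * (1 + (-σm) * cm / (σp * cp) * (1 + 0)) + am * cm / 2 * 0)) :=
    ((((hS.const_add 1).const_mul _).const_add 1).const_mul _).add (hS.const_mul _)
  have hval : ap * cp / 2 * (1 + (-σm) * cm / (σp * cp) * (1 + 0)) + am * cm / 2 * 0 =
      ap * (σp * cp + (-σm) * cm) / (2 * σp) := by
    field_simp
    ring
  rw [hval] at hlim
  refine hlim.congr' ?_
  filter_upwards [eventually_ge_atTop 1, hxbot.eventually_lt_atBot 0] with j hj hx
  have heq := (hτ j hj).2
  have htanh : Real.tanh (τ j * km * am) ≠ 0 := by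
    rw [Real.tanh_eq_sinh_div_cosh]
    exact div_ne_zero (Real.sinh_ne_zero.mpr hx.ne) (Real.cosh_pos _).ne'
  have htan : Real.tan (τ j * kp * ap) ≠ 0 := fun h0 => by
    rw [h0, mul_zero] at heq
    exact mul_ne_zero (mul_pos hσp hkp0).ne' htanh heq.symm
  have hsq : (-σm) * cm * Real.tan (τ j * kp * ap) ^ 2 =
      σp * cp * Real.tanh (τ j * km * am) ^ 2 := by
    have h2 := congrArg (· ^ 2) heq
    simp only [mul_pow, hkm2, hkp2] at h2
    have h3 : σm ^ 2 * (cm / (-σm)) = (-σm) * cm := by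
      field_simp
    have h4 : σp ^ 2 * (cp / σp) = σp * cp := by
      field_simp
    rwa [h3, h4] at h2
  have hinv : (Real.tan (τ j * kp * ap) ^ 2)⁻¹ =
      (-σm) * cm / (σp * cp) * (Real.tanh (τ j * km * am) ^ 2)⁻¹ := by
    field_simp
    linarith
  rw [← Real.inv_tanh_sq_eq_of_ne_zero hx.ne, ← hinv,
    ← Real.inv_sin_sq_eq_of_tan_ne_zero htan]
  simp only [div_eq_mul_inv, mul_inv]
  ring
end
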